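/- arXiv:2112.15055 — 6 statements merged into one kernel-verified Lean document; each statement's English description precedes it below -/
import Mathlib

section
/- Let p ≥ 2, θ ∈ (−π, π], and α, k ∈ ℝ. Let f(θ) be the p×p complex matrix with zeros on the diagonal, α on the superdiagonal and subdiagonal, α·e^{−iθ} in position (1,p), α·e^{iθ} in position (p,1), and zeros elsewhere; let g(θ) be the p×p complex matrix with k on the subdiagonal, k·e^{−iθ} in position (1,p), and zeros elsewhere. Then the matrix f(θ) + g(θ) is normal, i.e. it commutes with its conjugate transpose. -/
open Matrix

/-- The `p×p` matrix with `α` on the super- and sub-diagonal, `α·e^{-iθ}` in the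
top-right corner and `α·e^{iθ}` in the bottom-left corner (rows/columns indexed `0,…,p-1`). -/
noncomputable def fMat (p : ℕ) (α θ : ℝ) : Matrix (Fin p) (Fin p) ℂ :=
  Matrix.of fun i j =>
    (if (j : ℕ) = (i : ℕ) + 1 then (α : ℂ) else 0)
    + (if (i : ℕ) = (j : ℕ) + 1 then (α : ℂ) else 0)
    + (if (i : ℕ) = 0 ∧ (j : ℕ) = p - 1 then (α : ℂ) * Complex.exp (-(θ : ℂ) * Complex.I) else 0)
    + (if (i : ℕ) = p - 1 ∧ (j : ℕ) = 0 then (α : ℂ) * Complex.exp ((θ : ℂ) * Complex.I) else 0)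

/-- The `p×p` matrix with `k` on the sub-diagonal and `k·e^{-iθ}` in the top-right corner. -/
noncomputable def gMat (p : ℕ) (k θ : ℝ) : Matrix (Fin p) (Fin p) ℂ :=
  Matrix.of fun i j =>
    (if (i : ℕ) = (j : ℕ) + 1 then (k : ℂ) else 0)
    + (if (i : ℕ) = 0 ∧ (j : ℕ) = p - 1 then (k : ℂ) * Complex.exp (-(θ : ℂ) * Complex.I) else 0)

/-- The cyclic shift `e j ↦ e (j + 1)`, multiplied by the phase `e^{-iθ}` where it wraps around. -/
noncomputable def twistedShift (n : ℕ) (θ : ℝ) : Matrix (Fin (n + 2)) (Fin (n + 2)) ℂ :=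
  Matrix.of fun i j =>
    if j + 1 = i then (if i = 0 then Complex.exp (-(θ : ℂ) * Complex.I) else 1) else 0

theorem star_exp_neg_mul_I (θ : ℝ) :
    star (Complex.exp (-(θ : ℂ) * Complex.I)) = Complex.exp ((θ : ℂ) * Complex.I) := by
  rw [Complex.star_def, ← Complex.exp_conj]
  simp

theorem twistedShift_mul_conjTranspose (n : ℕ) (θ : ℝ) :
    twistedShift n θ * (twistedShift n θ)ᴴ = 1 := by
  ext i j
  rw [Matrix.mul_apply, Finset.sum_eq_single (i - 1)]
  · by_cases hij : i = j
    · subst hij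
      by_cases hi : i = 0
      · simp only [twistedShift, Matrix.conjTranspose_apply, Matrix.of_apply, sub_add_cancel,
          if_true, if_pos hi, star_exp_neg_mul_I, ← Complex.exp_add, Matrix.one_apply_eq]
        simp
      · simp [twistedShift, hi]
    · simp [twistedShift, hij]
  · intro l _ hl
    have : ¬ l + 1 = i := fun h => hl (eq_sub_of_add_eq h)
    simp [twistedShift, this]
  · simp

theorem twistedShift_apply (n : ℕ) (θ : ℝ) (i j : Fin (n + 2)) :
    twistedShift n θ i j = (if (i : ℕ) = (j : ℕ) + 1 then 1 else 0)
      + (if (i : ℕ) = 0 ∧ (j : ℕ) = n + 1 then Complex.exp (-(θ : ℂ) * Complex.I) else 0) := by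
  have hj := j.isLt
  have hi := i.isLt
  simp only [twistedShift, Matrix.of_apply, Fin.ext_iff, Fin.val_add_one, Fin.val_last,
    Fin.val_zero]
  split_ifs <;> first | omega | simp

theorem fMat_add_gMat_eq (n : ℕ) (α k θ : ℝ) :
    fMat (n + 2) α θ + gMat (n + 2) k θ =
      (α : ℂ) • (twistedShift n θ)ᴴ + ((α + k : ℝ) : ℂ) • twistedShift n θ := by
  ext i j
  simp only [fMat, gMat, Matrix.add_apply, Matrix.smul_apply, Matrix.conjTranspose_apply,
    Matrix.of_apply, twistedShift_apply, star_add, apply_ite star, star_exp_neg_mul_I, star_one,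
    star_zero, smul_eq_mul, Nat.add_succ_sub_one, Complex.ofReal_add, mul_add, add_mul, mul_ite,
    mul_one, mul_zero, and_comm (a := (j : ℕ) = 0)]
  split_ifs <;> ring

theorem fMat_add_gMat_normal (p : ℕ) (hp : 2 ≤ p) (θ : ℝ)
    (hθ : θ ∈ Set.Ioc (-Real.pi) Real.pi) (α k : ℝ) :
    (fMat p α θ + gMat p k θ) * (fMat p α θ + gMat p k θ)ᴴ =
      (fMat p α θ + gMat p k θ)ᴴ * (fMat p α θ + gMat p k θ) := by
  obtain ⟨n, rfl⟩ := Nat.exists_eq_add_of_le' hp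
  have h := twistedShift_mul_conjTranspose n θ
  have h' := mul_eq_one_comm.mp h
  rw [fMat_add_gMat_eq]
  simp only [Matrix.conjTranspose_add, Matrix.conjTranspose_smul,
    Matrix.conjTranspose_conjTranspose, Complex.star_def, Complex.conj_ofReal, add_mul, mul_add,
    smul_mul_assoc, mul_smul_comm, h, h']
  module
end

section
/- Let p ≥ 2, θ ∈ (−π, π], and k ∈ ℝ. Let g(θ) be the p×p complex matrix with k on the subdiagonal, k·e^{−iθ} in position (1,p), and zeros elsewhere. Then the spectrum (set of eigenvalues) of g(θ) is exactly { k·e^{i(2rπ−θ)/p} : r = 0, 1, …, p−1 }. -/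
open Matrix

theorem gMat_mulVec_zero (n : ℕ) (k θ : ℝ) (v : Fin (n + 1) → ℂ) :
    (gMat (n + 1) k θ *ᵥ v) 0 =
      (k : ℂ) * Complex.exp (-(θ : ℂ) * Complex.I) * v (Fin.last n) := by
  rw [Matrix.mulVec, dotProduct, Finset.sum_eq_single (Fin.last n)]
  · simp [gMat]
  · intro j _ hj
    have h : (j : ℕ) ≠ n := fun h => hj (Fin.ext h)
    simp [gMat, h]
  · simp

theorem gMat_mulVec_succ (n : ℕ) (k θ : ℝ) (v : Fin (n + 1) → ℂ) (i : Fin n) :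
    (gMat (n + 1) k θ *ᵥ v) i.succ = (k : ℂ) * v i.castSucc := by
  rw [Matrix.mulVec, dotProduct, Finset.sum_eq_single i.castSucc]
  · simp [gMat]
  · intro j _ hj
    have h : (i : ℕ) ≠ j := fun h => hj (Fin.ext h.symm)
    simp [gMat, h]
  · simp

theorem Matrix.mem_spectrum_iff_exists_mulVec {m K : Type*} [Fintype m] [DecidableEq m] [Field K]
    (A : Matrix m m K) (z : K) :
    z ∈ spectrum K A ↔ ∃ v : m → K, v ≠ 0 ∧ A *ᵥ v = z • v := by
  rw [← Matrix.spectrum_toLin', ← Module.End.hasEigenvalue_iff_mem_spectrum]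
  constructor
  · intro h
    obtain ⟨v, hv⟩ := h.exists_hasEigenvector
    exact ⟨v, hv.2, by simpa using hv.apply_eq_smul⟩
  · rintro ⟨v, hv, h⟩
    exact Module.End.hasEigenvalue_of_hasEigenvector
      ⟨Module.End.mem_eigenspace_iff.2 (by simpa using h), hv⟩

/-- An eigenvalue of `gMat` satisfies its characteristic equation. -/
theorem pow_eq_of_gMat_mulVec_eq_smul (n : ℕ) (k θ : ℝ) (hk : k ≠ 0) (z : ℂ)
    (v : Fin (n + 1) → ℂ) (hv : v ≠ 0) (h : gMat (n + 1) k θ *ᵥ v = z • v) :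
    z ^ (n + 1) = (k : ℂ) ^ (n + 1) * Complex.exp (-(θ : ℂ) * Complex.I) := by
  have hk' : (k : ℂ) ≠ 0 := by exact_mod_cast hk
  have h_zero : (k : ℂ) * Complex.exp (-(θ : ℂ) * Complex.I) * v (Fin.last n) = z * v 0 := by
    rw [← gMat_mulVec_zero n, h]; rfl
  have h_succ (i : Fin n) : (k : ℂ) * v i.castSucc = z * v i.succ := by
    rw [← gMat_mulVec_succ n k θ, h]; rfl
  have key (i : Fin (n + 1)) :
      (k : ℂ) ^ (n - (i : ℕ)) * v i = z ^ (n - (i : ℕ)) * v (Fin.last n) := by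
    induction i using Fin.reverseInduction with
    | last => simp
    | cast i ih =>
      have e : n - (i : ℕ) = n - (i.succ : ℕ) + 1 := by
        have := i.isLt
        simp only [Fin.val_succ]
        omega
      rw [Fin.val_castSucc, e, pow_succ, mul_assoc, h_succ, pow_succ]
      linear_combination z * ih
  have hlast : v (Fin.last n) ≠ 0 := by
    intro h0
    apply hv
    ext i
    have := key i
    rw [h0, mul_zero] at this
    simpa [hk'] using this
  have h0 := key 0
  simp only [Fin.val_zero, Nat.sub_zero] at h0
  apply mul_right_cancel₀ hlast
  linear_combination (-z) * h0 - (k : ℂ) ^ n * h_zero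

theorem spectrum_gMat (p : ℕ) (hp : 2 ≤ p) (θ : ℝ)
    (hθ : θ ∈ Set.Ioc (-Real.pi) Real.pi) (k : ℝ) :
    spectrum ℂ (gMat p k θ) =
      {z : ℂ | ∃ r : Fin p,
        z = (k : ℂ) * Complex.exp (Complex.I *
          (((2 * (r : ℕ) * Real.pi - θ) / p : ℝ) : ℂ))} := by
  have hp0 : (p : ℂ) ≠ 0 := by exact_mod_cast (by omega : p ≠ 0)
  have hexp (r : ℕ) : Complex.exp (Complex.I * (((2 * r * Real.pi - θ) / p : ℝ) : ℂ)) =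
      Complex.exp (2 * Real.pi * Complex.I / p) ^ r * Complex.exp (-(θ : ℂ) * Complex.I / p) := by
    rw [← Complex.exp_nat_mul, ← Complex.exp_add]
    congr 1
    push_cast
    ring
  have hroot : Complex.exp (-(θ : ℂ) * Complex.I / p) ^ p =
      Complex.exp (-(θ : ℂ) * Complex.I) := by
    rw [← Complex.exp_nat_mul, mul_div_cancel₀ _ hp0]
  have hprim := Complex.isPrimitiveRoot_exp p (by omega)
  ext z
  rw [Matrix.mem_spectrum_iff_exists_mulVec, Set.mem_ofPred_eq]
  simp only [hexp]
  generalize Complex.exp (2 * Real.pi * Complex.I / p) = ζ at hprim ⊢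
  have hα : Complex.exp (-(θ : ℂ) * Complex.I / p) ≠ 0 := Complex.exp_ne_zero _
  generalize Complex.exp (-(θ : ℂ) * Complex.I / p) = α at hroot hα ⊢
  obtain ⟨n, rfl⟩ : ∃ n, p = n + 1 := ⟨p - 1, by omega⟩
  constructor
  · rintro ⟨v, hv, h⟩
    by_cases hk : k = 0
    · refine ⟨0, ?_⟩
      have hg : gMat (n + 1) k θ = 0 := by
        ext i j
        simp [gMat, hk]
      rw [hg, Matrix.zero_mulVec, eq_comm, smul_eq_zero] at h
      simpa [hk] using h.resolve_right hv
    · have hk' : (k : ℂ) ≠ 0 := by exact_mod_cast hk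
      have hz := pow_eq_of_gMat_mulVec_eq_smul n k θ hk z v hv h
      have h1 : (z / (k * α)) ^ (n + 1) = 1 := by
        rw [div_pow, mul_pow, hroot, hz, div_self]
        exact mul_ne_zero (pow_ne_zero _ hk') (Complex.exp_ne_zero _)
      obtain ⟨r, hr, e⟩ := hprim.eq_pow_of_pow_eq_one h1
      refine ⟨⟨r, hr⟩, ?_⟩
      rw [e]
      field_simp
  · rintro ⟨r, rfl⟩
    have hω : (ζ ^ (r : ℕ) * α) ^ (n + 1) = Complex.exp (-(θ : ℂ) * Complex.I) := by
      rw [mul_pow, hroot, pow_right_comm, hprim.pow_eq_one, one_pow, one_mul]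
    generalize ζ ^ (r : ℕ) * α = ω at hω ⊢
    refine ⟨fun j => ω ^ (n - (j : ℕ)), fun h => ?_, ?_⟩
    · simpa using congrFun h (Fin.last n)
    · ext i
      refine Fin.cases ?_ (fun i => ?_) i
      · rw [gMat_mulVec_zero n, ← hω]
        simp [pow_succ]
        ring
      · rw [gMat_mulVec_succ]
        have e : n - (i : ℕ) = n - (i.succ : ℕ) + 1 := by
          have := i.isLt
          simp only [Fin.val_succ]
          omega
        simp only [Fin.val_castSucc, Pi.smul_apply, smul_eq_mul]
        rw [e, pow_succ]
        ring
end

section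
/- Let p ≥ 2, θ ∈ (−π, π], and α ∈ ℝ. Let f(θ) be the p×p complex matrix with zeros on the diagonal, α on the superdiagonal and subdiagonal, α·e^{−iθ} in position (1,p), α·e^{iθ} in position (p,1), and zeros elsewhere. Then the spectrum of f(θ) is exactly { α·e^{i(2rπ−θ)/p} + α·e^{−i(2rπ−θ)/p} : r = 0, 1, …, p−1 }. -/
open Matrix

/-- For `w ^ p = e^{iθ}`, the vector `(w ^ j)` is an eigenvector of `fMat p α θ`. -/
lemma fMat_mulVec_pow {p : ℕ} (hp : 2 ≤ p) (α θ : ℝ) {w : ℂ}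
    (hw : w ^ p = Complex.exp ((θ : ℂ) * Complex.I)) (i : Fin p) :
    ∑ j : Fin p, fMat p α θ i j * w ^ (j : ℕ) = w ^ (i : ℕ) * (α * w⁻¹ + α * w) := by
  have hw0 : w ≠ 0 := by
    rintro rfl
    rw [zero_pow (by lia)] at hw
    exact Complex.exp_ne_zero _ hw.symm
  have hE : Complex.exp (-(θ : ℂ) * Complex.I) = (w ^ p)⁻¹ := by
    rw [hw, ← Complex.exp_neg, neg_mul]
  obtain ⟨i, hi⟩ := i
  obtain ⟨n, rfl⟩ : ∃ n, p = n + 2 := ⟨p - 2, by lia⟩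
  simp only [fMat, Matrix.of_apply, hE, ← hw, add_mul, Finset.sum_add_distrib, ite_mul, zero_mul]
  rw [Fin.sum_univ_eq_sum_range (fun j => if j = i + 1 then (α : ℂ) * w ^ j else 0),
    Fin.sum_univ_eq_sum_range (fun j => if i = j + 1 then (α : ℂ) * w ^ j else 0),
    Fin.sum_univ_eq_sum_range (fun j => if i = 0 ∧ j = n + 2 - 1 then
      (α : ℂ) * (w ^ (n + 2))⁻¹ * w ^ j else 0),
    Fin.sum_univ_eq_sum_range (fun j => if i = n + 2 - 1 ∧ j = 0 then
      (α : ℂ) * w ^ (n + 2) * w ^ j else 0)]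
  have h₁ : i = 0 ∨ ∃ k, i = k + 1 := by
    cases i <;> simp
  rcases h₁ with rfl | ⟨k, rfl⟩
  · simp
    field_simp
    ring
  · have hk : k < n + 2 := by lia
    rcases eq_or_ne k n with rfl | hkn
    · simp
      field_simp
      ring
    · have hk' : k < n := by lia
      simp [hkn, hk, hk']
      field_simp
      ring

lemma exp_neg_I_mul_pow {p : ℕ} (hp : p ≠ 0) (θ : ℝ) (r : ℕ) :
    Complex.exp (-(Complex.I * (((2 * r * Real.pi - θ) / p : ℝ) : ℂ))) ^ p =
      Complex.exp ((θ : ℂ) * Complex.I) := by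
  have hp' : (p : ℂ) ≠ 0 := by exact_mod_cast hp
  rw [← Complex.exp_nat_mul, Complex.exp_eq_exp_iff_exists_int]
  refine ⟨-r, ?_⟩
  push_cast
  field_simp
  ring

lemma exp_neg_I_mul_injective (p : ℕ) (θ : ℝ) :
    Function.Injective fun r : Fin p =>
      Complex.exp (-(Complex.I * (((2 * (r : ℕ) * Real.pi - θ) / p : ℝ) : ℂ))) := by
  intro r s h
  have hp : (p : ℂ) ≠ 0 := by exact_mod_cast r.pos.ne'
  obtain ⟨n, hn⟩ := Complex.exp_eq_exp_iff_exists_int.mp h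
  have hc : (2 * Real.pi * Complex.I) * ((s : ℕ) : ℂ) =
      (2 * Real.pi * Complex.I) * ((r : ℕ) + n * p) := by
    push_cast at hn
    field_simp at hn
    linear_combination Complex.I * hn
  have hz : ((s : ℕ) : ℤ) = (r : ℕ) + n * p := by
    exact_mod_cast mul_left_cancel₀ Complex.two_pi_I_ne_zero hc
  have hm := congrArg (· % (p : ℤ)) hz
  simp only [Int.add_mul_emod_self_right] at hm
  norm_cast at hm
  rw [Nat.mod_eq_of_lt s.isLt, Nat.mod_eq_of_lt r.isLt] at hm
  exact Fin.ext hm.symm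

theorem spectrum_fMat (p : ℕ) (hp : 2 ≤ p) (θ : ℝ)
    (hθ : θ ∈ Set.Ioc (-Real.pi) Real.pi) (α : ℝ) :
    spectrum ℂ (fMat p α θ) =
      {z : ℂ | ∃ r : Fin p,
        z = (α : ℂ) * Complex.exp (Complex.I * (((2 * (r : ℕ) * Real.pi - θ) / p : ℝ) : ℂ))
          + (α : ℂ) * Complex.exp (-(Complex.I * (((2 * (r : ℕ) * Real.pi - θ) / p : ℝ) : ℂ)))} := by
  let w : Fin p → ℂ := fun r =>
    Complex.exp (-(Complex.I * (((2 * (r : ℕ) * Real.pi - θ) / p : ℝ) : ℂ)))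
  let V : Matrix (Fin p) (Fin p) ℂ := (vandermonde w)ᵀ
  have hV : IsUnit V := by
    rw [Matrix.isUnit_iff_isUnit_det, det_transpose, isUnit_iff_ne_zero,
      det_vandermonde_ne_zero_iff]
    exact exp_neg_I_mul_injective p θ
  obtain ⟨u, hu⟩ := hV
  have hAV : fMat p α θ * V = V * diagonal fun r => (α : ℂ) * (w r)⁻¹ + α * w r := by
    ext i r
    rw [mul_diagonal, mul_apply]
    exact fMat_mulVec_pow hp α θ (exp_neg_I_mul_pow (by lia) θ r) i
  have hA : fMat p α θ = (u : Matrix (Fin p) (Fin p) ℂ) *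
      (diagonal fun r => (α : ℂ) * (w r)⁻¹ + α * w r) * (u⁻¹ : (Matrix (Fin p) (Fin p) ℂ)ˣ) := by
    rw [hu, ← hAV, ← hu, Units.mul_inv_cancel_right]
  rw [hA, spectrum.units_conjugate, spectrum_diagonal]
  ext z
  simp only [Set.mem_range, Set.mem_ofPred_eq, w, ← Complex.exp_neg, neg_neg, eq_comm]
end

section
/- Let p ≥ 1 and let a, b, c : ℤ → ℝ be p-periodic sequences (a_{i+p} = a_i, b_{i+p} = b_i, c_{i+p} = c_i for all i ∈ ℤ). Let J be the bounded linear operator on ℓ²(ℤ) defined by (Ju)_n = c_{n−1}u_{n−1} + a_n u_n + b_n u_{n+1}, and for θ ∈ (−π, π] let φ(θ) be the p×p symbol matrix of J. Then the spectrum of J equals the union over θ ∈ (−π, π] of the spectra of the matrices φ(θ): σ(J) = ⋃_{−π<θ≤π} σ(φ(θ)). -/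
open Matrix

/-- The `p×p` symbol matrix of the periodic Jacobi operator: diagonal entries
`a 0, …, a (p-1)`, superdiagonal entries `b 0, …, b (p-2)`, subdiagonal entries
`c 0, …, c (p-2)`, entry `c (p-1) · e^{-iθ}` in the top-right corner and
`b (p-1) · e^{iθ}` in the bottom-left corner (rows/columns indexed `0,…,p-1`). -/
noncomputable def symbolMat (p : ℕ) (a b c : ℤ → ℝ) (θ : ℝ) : Matrix (Fin p) (Fin p) ℂ :=
  Matrix.of fun i j =>
    (if (i : ℕ) = (j : ℕ) then (a ((i : ℕ) : ℤ) : ℂ) else 0)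
    + (if (j : ℕ) = (i : ℕ) + 1 then (b ((i : ℕ) : ℤ) : ℂ) else 0)
    + (if (i : ℕ) = (j : ℕ) + 1 then (c ((j : ℕ) : ℤ) : ℂ) else 0)
    + (if (i : ℕ) = 0 ∧ (j : ℕ) = p - 1 then
        (c ((p : ℤ) - 1) : ℂ) * Complex.exp (-(θ : ℂ) * Complex.I) else 0)
    + (if (i : ℕ) = p - 1 ∧ (j : ℕ) = 0 then
        (b ((p : ℤ) - 1) : ℂ) * Complex.exp ((θ : ℂ) * Complex.I) else 0)

section WeightedComp

variable {ι κ : Type*}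

theorem memℓp_two_mul_comp (g : ι → ℂ) (hg : ∀ k, ‖g k‖ ≤ 1) {f : ι → κ}
    (hf : Function.Injective f) (u : lp (fun _ : κ => ℂ) 2) :
    Memℓp (fun k => g k * u (f k)) 2 := by
  have hu := (lp.memℓp u).summable (by norm_num)
  refine memℓp_gen (Summable.of_nonneg_of_le (fun _ => by positivity) (fun k => ?_)
    (hu.comp_injective hf))
  simp only [norm_mul, Function.comp_apply]
  gcongr
  exact mul_le_of_le_one_left (norm_nonneg _) (hg k)

/-- The contraction `u ↦ (k ↦ g k * u (f k))` of `ℓ²` spaces, for `f` injective and `|g| ≤ 1`. -/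
noncomputable def lpWeightedComp (g : ι → ℂ) (hg : ∀ k, ‖g k‖ ≤ 1) (f : ι → κ)
    (hf : Function.Injective f) :
    lp (fun _ : κ => ℂ) 2 →L[ℂ] lp (fun _ : ι => ℂ) 2 :=
  LinearMap.mkContinuous
    { toFun := fun u => ⟨fun k => g k * u (f k), memℓp_two_mul_comp g hg hf u⟩
      map_add' := fun u v => by
        ext k
        exact mul_add (g k) (u (f k)) (v (f k))
      map_smul' := fun r u => by
        ext k
        simp [mul_left_comm] } 1 fun u => by
    have hu := (lp.memℓp u).summable (p := 2) (by norm_num)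
    rw [one_mul]
    refine lp.norm_le_of_tsum_le (by norm_num) (norm_nonneg _) ?_
    rw [lp.norm_rpow_eq_tsum (by norm_num) u]
    refine le_trans (Summable.tsum_le_tsum (fun k => ?_)
      ((memℓp_two_mul_comp g hg hf u).summable (by norm_num)) (hu.comp_injective hf))
      (tsum_comp_le_tsum_of_inj hu (fun _ => by positivity) hf)
    simp only [LinearMap.coe_mk, AddHom.coe_mk, norm_mul, Function.comp_apply]
    gcongr
    exact mul_le_of_le_one_left (norm_nonneg _) (hg k)

@[simp]
theorem lpWeightedComp_apply (g : ι → ℂ) (hg : ∀ k, ‖g k‖ ≤ 1) (f : ι → κ)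
    (hf : Function.Injective f) (u : lp (fun _ : κ => ℂ) 2) (k : ι) :
    lpWeightedComp g hg f hf u k = g k * u (f k) := rfl

theorem norm_lpWeightedComp_le (g : ι → ℂ) (hg : ∀ k, ‖g k‖ ≤ 1) (f : ι → κ)
    (hf : Function.Injective f) : ‖lpWeightedComp g hg f hf‖ ≤ 1 :=
  LinearMap.mkContinuous_norm_le _ zero_le_one _

open Classical in
theorem adjoint_lpWeightedComp_apply (g : ι → ℂ) (hg : ∀ k, ‖g k‖ ≤ 1) (f : ι → κ)
    (hf : Function.Injective f) (u : lp (fun _ : ι => ℂ) 2) (k : ι) :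
    ContinuousLinearMap.adjoint (lpWeightedComp g hg f hf) u (f k) = star (g k) * u k := by
  have h1 := lp.inner_single_left (𝕜 := ℂ) (f k) (1 : ℂ)
    (ContinuousLinearMap.adjoint (lpWeightedComp g hg f hf) u)
  have h2 : lpWeightedComp g hg f hf (lp.single 2 (f k) (1 : ℂ)) = lp.single 2 k (g k) := by
    ext l
    by_cases h : l = k
    · subst h; simp
    · simp [h, hf.ne h]
  rw [ContinuousLinearMap.adjoint_inner_right, h2, lp.inner_single_left] at h1
  simpa [mul_comm] using h1.symm

open Classical in
theorem adjoint_lpWeightedComp_apply_of_notMem (g : ι → ℂ) (hg : ∀ k, ‖g k‖ ≤ 1) (f : ι → κ)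
    (hf : Function.Injective f) (u : lp (fun _ : ι => ℂ) 2) {n : κ} (hn : n ∉ Set.range f) :
    ContinuousLinearMap.adjoint (lpWeightedComp g hg f hf) u n = 0 := by
  have h1 := lp.inner_single_left (𝕜 := ℂ) n (1 : ℂ)
    (ContinuousLinearMap.adjoint (lpWeightedComp g hg f hf) u)
  have h2 : lpWeightedComp g hg f hf (lp.single 2 n (1 : ℂ)) = 0 := by
    ext l
    have : f l ≠ n := fun h => hn ⟨l, h⟩
    simp [this]
  rw [ContinuousLinearMap.adjoint_inner_right, h2] at h1
  simpa using h1.symm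

end WeightedComp

section Pencil

variable {n : Type*} [Fintype n] [DecidableEq n]

/-- The matrix `r • A + s • B + t • C` over an algebra, for scalar matrices `A`, `B`, `C`. -/
def matrixPencil {R : Type*} [Ring R] [Algebra ℂ R] (A B C : Matrix n n ℂ) (r s t : R) :
    Matrix n n R :=
  Matrix.of fun i j => A i j • r + B i j • s + C i j • t

theorem map_matrixPencil {R R' : Type*} [Ring R] [Algebra ℂ R] [Ring R'] [Algebra ℂ R']
    (f : R →ₐ[ℂ] R') (A B C : Matrix n n ℂ) (r s t : R) :
    f.mapMatrix (matrixPencil A B C r s t) = matrixPencil A B C (f r) (f s) (f t) := by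
  ext i j
  simp [matrixPencil]

theorem algebraMap_sub_matrixPencil {R : Type*} [Ring R] [Algebra ℂ R] (A B C : Matrix n n ℂ)
    (z : ℂ) (s t : R) :
    algebraMap ℂ (Matrix n n R) z - matrixPencil A B C 1 s t =
      matrixPencil (algebraMap ℂ (Matrix n n ℂ) z - A) (-B) (-C) 1 s t := by
  ext i j
  by_cases h : i = j
  · subst h
    simp [matrixPencil, sub_smul, Algebra.algebraMap_eq_smul_one]
    abel
  · simp [matrixPencil, Matrix.algebraMap_matrix_apply, h]
    abel

/-- The determinant of the pencil `X A + X² B + C`. -/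
noncomputable def pencilPoly (A B C : Matrix n n ℂ) : Polynomial ℂ :=
  (matrixPencil A B C Polynomial.X (Polynomial.X ^ 2) 1).det

theorem isUnit_matrixPencil_iff_aeval {R : Type*} [CommRing R] [Algebra ℂ R]
    (A B C : Matrix n n ℂ) {x y : R} (hxy : x * y = 1) :
    IsUnit (matrixPencil A B C 1 x y) ↔ IsUnit (Polynomial.aeval x (pencilPoly A B C)) := by
  have h : Polynomial.aeval x (pencilPoly A B C) =
      x ^ Fintype.card n * (matrixPencil A B C 1 x y).det := by
    rw [pencilPoly, AlgHom.map_det, map_matrixPencil, ← Matrix.det_smul]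
    congr 1
    ext i j
    simp [matrixPencil, mul_add, hxy, pow_two]
  rw [h, Matrix.isUnit_iff_isUnit_det, IsUnit.mul_iff]
  exact ⟨fun hd => ⟨(IsUnit.of_mul_eq_one y hxy).pow _, hd⟩, And.right⟩

end Pencil

section DoubleCentralizer

variable {R : Type*} [Ring R] [Algebra ℂ R]

/-- The double centralizer of an element of an algebra. -/
abbrev bicentralizer (x : R) : Subalgebra ℂ R :=
  Subalgebra.centralizer ℂ (Set.centralizer {x})

theorem self_mem_bicentralizer (x : R) : x ∈ bicentralizer x :=
  Set.subset_centralizer_centralizer (Set.mem_singleton x)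

theorem bicentralizer_comm (x : R) (y z : bicentralizer x) : y * z = z * y :=
  Subtype.ext (Set.centralizer_centralizer_comm_of_comm
    (by rintro _ rfl _ rfl; rfl) _ y.2 _ z.2)

theorem isUnit_of_isUnit_coe {x : R} {y : bicentralizer x} (hy : IsUnit (y : R)) : IsUnit y := by
  obtain ⟨v, hv⟩ := hy
  have hmem : (↑v⁻¹ : R) ∈ bicentralizer x := fun g hg => by
    have : Commute g (v : R) := hv ▸ y.2 g hg
    exact this.units_inv_right
  refine ⟨⟨y, ⟨_, hmem⟩, ?_, ?_⟩, rfl⟩ <;> ext <;> simp [← hv]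

theorem isUnit_of_isUnit_mapMatrix {n : Type*} [Fintype n] [DecidableEq n] {x : R}
    {M : Matrix n n (bicentralizer x)} (hM : IsUnit ((bicentralizer x).val.mapMatrix M)) :
    IsUnit M := by
  obtain ⟨V, hV⟩ := hM
  have hmem : ∀ i j, (↑V⁻¹ : Matrix n n R) i j ∈ bicentralizer x := fun i j g hg => by
    have h : Commute (Matrix.scalar n g) (V : Matrix n n R) := by
      ext k l
      simpa [hV, Matrix.scalar_apply, Matrix.diagonal_mul, Matrix.mul_diagonal]
        using (M k l).2 g hg
    simpa [Matrix.scalar_apply, Matrix.diagonal_mul, Matrix.mul_diagonal] using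
      congr_fun₂ h.units_inv_right.eq i j
  have hinj : Function.Injective ((bicentralizer x).val.mapMatrix (m := n)) :=
    fun P Q h => Matrix.map_injective Subtype.val_injective h
  have hN : (bicentralizer x).val.mapMatrix (Matrix.of fun i j => ⟨_, hmem i j⟩) =
      (↑V⁻¹ : Matrix n n R) := rfl
  refine ⟨⟨M, Matrix.of fun i j => ⟨_, hmem i j⟩, hinj ?_, hinj ?_⟩, rfl⟩ <;>
    rw [map_mul, hN, ← hV] <;> simp

theorem isUnit_matrixPencil_iff_forall_mem_spectrum {n : Type*} [Fintype n] [DecidableEq n]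
    (A B C : Matrix n n ℂ) {x y : R} (hxy : x * y = 1) (hyx : y * x = 1)
    (hx : (spectrum ℂ x).Nonempty) :
    IsUnit (matrixPencil A B C 1 x y) ↔
      ∀ w ∈ spectrum ℂ x, IsUnit (matrixPencil A B C 1 w w⁻¹) := by
  let _ : CommRing (bicentralizer x) :=
    { (inferInstance : Ring (bicentralizer x)) with mul_comm := bicentralizer_comm x }
  have hy : y ∈ bicentralizer x := fun g hg => by
    have : Commute g ((⟨x, y, hxy, hyx⟩ : Rˣ) : R) := (hg x rfl).symm
    exact this.units_inv_right
  let x' : bicentralizer x := ⟨x, self_mem_bicentralizer x⟩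
  let y' : bicentralizer x := ⟨y, hy⟩
  have hxy' : x' * y' = 1 := Subtype.ext hxy
  have h1 : (bicentralizer x).val.mapMatrix (matrixPencil A B C 1 x' y') =
      matrixPencil A B C 1 x y := map_matrixPencil _ _ _ _ _ _ _
  have h2 : (Polynomial.aeval x' (pencilPoly A B C) : R) =
      Polynomial.aeval x (pencilPoly A B C) :=
    (Polynomial.aeval_algHom_apply (bicentralizer x).val x' _).symm
  have hx0 : ∀ w ∈ spectrum ℂ x, w ≠ 0 := fun w hw h0 =>
    spectrum.zero_notMem ℂ (⟨⟨x, y, hxy, hyx⟩, rfl⟩ : IsUnit x) (h0 ▸ hw)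
  calc IsUnit (matrixPencil A B C 1 x y)
      ↔ IsUnit (matrixPencil A B C 1 x' y') := by
        rw [← h1]
        exact ⟨isUnit_of_isUnit_mapMatrix, fun h => h.map _⟩
    _ ↔ IsUnit (Polynomial.aeval x (pencilPoly A B C)) := by
        rw [isUnit_matrixPencil_iff_aeval A B C hxy', ← h2]
        exact ⟨fun h => h.map (bicentralizer x).val, isUnit_of_isUnit_coe⟩
    _ ↔ ∀ w ∈ spectrum ℂ x, IsUnit (matrixPencil A B C 1 w w⁻¹) := by
        rw [← spectrum.zero_notMem_iff ℂ, spectrum.map_polynomial_aeval_of_nonempty _ _ hx]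
        simp only [Set.mem_image, not_exists, not_and]
        refine forall₂_congr fun w hw => ?_
        rw [isUnit_matrixPencil_iff_aeval A B C (mul_inv_cancel₀ (hx0 w hw)), isUnit_iff_ne_zero]
        simp

end DoubleCentralizer

section Compression

variable {n R : Type*} [Fintype n] [DecidableEq n] [Ring R] [Algebra ℂ R]

/-- The isomorphism of `R` with its matrix algebra given by elements `V i`, `W i` satisfying
the Cuntz relations. -/
def cuntzEquiv (V W : n → R) (hWV : ∀ i j, W i * V j = if i = j then 1 else 0)
    (hVW : ∑ i, V i * W i = 1) : R ≃ₐ[ℂ] Matrix n n R where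
  toFun x := Matrix.of fun i j => W i * x * V j
  invFun M := ∑ i, ∑ j, V i * M i j * W j
  left_inv x := by
    have : ∑ i, ∑ j, V i * (W i * x * V j) * W j = (∑ i, V i * W i) * x * ∑ j, V j * W j := by
      simp only [Finset.sum_mul, Finset.mul_sum, mul_assoc]
      exact Finset.sum_comm
    simpa [hVW] using this
  right_inv M := by
    ext i j
    have : ∀ k l, W i * (V k * M k l * W l) * V j = (W i * V k) * M k l * (W l * V j) := by
      simp [mul_assoc]
    simp [Finset.mul_sum, Finset.sum_mul, this, hWV]
  map_mul' x y := by
    ext i j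
    have : ∀ k, W i * x * V k * (W k * y * V j) = W i * x * (V k * W k) * (y * V j) := by
      simp [mul_assoc]
    simp only [Matrix.mul_apply, Matrix.of_apply, this]
    rw [← Finset.sum_mul, ← Finset.mul_sum, hVW]
    simp [mul_assoc]
  map_add' x y := by
    ext i j
    simp [mul_add, add_mul]
  commutes' r := by
    ext i j
    by_cases h : i = j <;>
      simp [Algebra.algebraMap_eq_smul_one, hWV, h]

end Compression

section BilateralShift

/-- The bilateral shift `(S u) k = u (k + 1)`. -/
noncomputable def lpShift : lp (fun _ : ℤ => ℂ) 2 →L[ℂ] lp (fun _ : ℤ => ℂ) 2 :=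
  lpWeightedComp (fun _ => 1) (by simp) (· + 1) (add_left_injective 1)

/-- The inverse bilateral shift `(T u) k = u (k - 1)`. -/
noncomputable def lpShiftInv : lp (fun _ : ℤ => ℂ) 2 →L[ℂ] lp (fun _ : ℤ => ℂ) 2 :=
  lpWeightedComp (fun _ => 1) (by simp) (· - 1) (sub_left_injective)

@[simp]
theorem lpShift_apply (u : lp (fun _ : ℤ => ℂ) 2) (k : ℤ) : lpShift u k = u (k + 1) :=
  one_mul _

@[simp]
theorem lpShiftInv_apply (u : lp (fun _ : ℤ => ℂ) 2) (k : ℤ) : lpShiftInv u k = u (k - 1) :=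
  one_mul _

theorem lpShift_mul_lpShiftInv : lpShift * lpShiftInv = 1 := by
  ext u k
  simp

theorem lpShiftInv_mul_lpShift : lpShiftInv * lpShift = 1 := by
  ext u k
  simp

instance : Nontrivial (lp (fun _ : ℤ => ℂ) 2) :=
  ⟨⟨lp.single 2 0 1, 0, fun h => by simpa using congrArg (fun u => u 0) h⟩⟩

theorem norm_eq_one_of_mem_spectrum_lpShift {w : ℂ} (hw : w ∈ spectrum ℂ lpShift) : ‖w‖ = 1 := by
  let S : (lp (fun _ : ℤ => ℂ) 2 →L[ℂ] lp (fun _ : ℤ => ℂ) 2)ˣ :=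
    ⟨lpShift, lpShiftInv, lpShift_mul_lpShiftInv, lpShiftInv_mul_lpShift⟩
  have hw0 : w ≠ 0 := fun h0 => spectrum.zero_notMem ℂ S.isUnit (h0 ▸ hw)
  have h1 : ‖w‖ ≤ 1 := (spectrum.norm_le_norm_of_mem hw).trans (norm_lpWeightedComp_le _ _ _ _)
  have h2 : w⁻¹ ∈ spectrum ℂ lpShiftInv :=
    (spectrum.inv_mem_iff (r := Units.mk0 w hw0) (a := S)).1 hw
  have h3 : ‖w⁻¹‖ ≤ 1 := (spectrum.norm_le_norm_of_mem h2).trans (norm_lpWeightedComp_le _ _ _ _)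
  rw [norm_inv] at h3
  exact le_antisymm h1 ((inv_le_one₀ (norm_pos_iff.2 hw0)).1 h3)

theorem smul_mem_spectrum_lpShift {v w : ℂ} (hv : ‖v‖ = 1) (hw : w ∈ spectrum ℂ lpShift) :
    v * w ∈ spectrum ℂ lpShift := by
  have hv0 : v ≠ 0 := norm_ne_zero_iff.1 (by simp [hv])
  let D (v : ℂ) (hv : ‖v‖ = 1) : lp (fun _ : ℤ => ℂ) 2 →L[ℂ] lp (fun _ : ℤ => ℂ) 2 :=
    lpWeightedComp (fun k : ℤ => v ^ k) (by simp [hv]) id Function.injective_id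
  have hv' : ‖v⁻¹‖ = 1 := by simp [hv]
  let U : (lp (fun _ : ℤ => ℂ) 2 →L[ℂ] lp (fun _ : ℤ => ℂ) 2)ˣ :=
    ⟨D v⁻¹ hv', D v hv, by ext u k; simp [D, zpow_ne_zero k hv0],
      by ext u k; simp [D, zpow_ne_zero k hv0]⟩
  have h : (U : lp (fun _ : ℤ => ℂ) 2 →L[ℂ] lp (fun _ : ℤ => ℂ) 2) * lpShift * ↑U⁻¹ =
      Units.mk0 v hv0 • lpShift := by
    ext u k
    change v⁻¹ ^ k * (lpShift (D v hv u) k) = v * lpShift u k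
    simp only [lpShift_apply, D, lpWeightedComp_apply, id, zpow_add₀ hv0,
      _root_.inv_zpow, zpow_one]
    field_simp [zpow_ne_zero k hv0]
  rw [← spectrum.units_conjugate (u := U), h, spectrum.unit_smul_eq_smul]
  exact Set.smul_mem_smul_set hw

theorem mem_spectrum_lpShift {w : ℂ} : w ∈ spectrum ℂ lpShift ↔ ‖w‖ = 1 := by
  refine ⟨norm_eq_one_of_mem_spectrum_lpShift, fun hw => ?_⟩
  obtain ⟨v, hv⟩ := spectrum.nonempty lpShift
  have hv1 := norm_eq_one_of_mem_spectrum_lpShift hv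
  have hv0 : v ≠ 0 := norm_ne_zero_iff.1 (by simp [hv1])
  simpa [hv0] using smul_mem_spectrum_lpShift (v := w * v⁻¹) (by simp [hw, hv1]) hv

end BilateralShift

section Residue

variable {p : ℕ}

theorem residue_injective (i : Fin p) :
    Function.Injective fun k : ℤ => (i : ℤ) + p * k := fun k l h => by
  have : p ≠ 0 := i.pos.ne'
  simpa [this] using h

/-- Restriction of a sequence to the residue class of `i` modulo `p`. -/
noncomputable def lpResidue (i : Fin p) : lp (fun _ : ℤ => ℂ) 2 →L[ℂ] lp (fun _ : ℤ => ℂ) 2 :=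
  lpWeightedComp (fun _ => 1) (by simp) _ (residue_injective i)

theorem lpResidue_apply (i : Fin p) (u : lp (fun _ : ℤ => ℂ) 2) (k : ℤ) :
    lpResidue i u k = u (i + p * k) :=
  one_mul _

theorem exists_eq_residue (hp : 1 ≤ p) (n : ℤ) : ∃ (m : Fin p) (k : ℤ), n = m + p * k := by
  have hp' : (0 : ℤ) < p := by omega
  have h0 := Int.emod_nonneg n hp'.ne'
  have h1 := Int.emod_lt_of_pos n hp'
  refine ⟨⟨(n % p).toNat, by omega⟩, n / p, ?_⟩
  have := Int.emod_add_mul_ediv n p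
  simp only [Int.toNat_of_nonneg h0]
  exact this.symm

theorem adjoint_lpResidue_apply (j m : Fin p) (u : lp (fun _ : ℤ => ℂ) 2) (k : ℤ) :
    ContinuousLinearMap.adjoint (lpResidue j) u (m + p * k) = if m = j then u k else 0 := by
  split_ifs with h
  · subst h
    exact (adjoint_lpWeightedComp_apply _ _ _ (residue_injective m) u k).trans (by simp)
  · refine adjoint_lpWeightedComp_apply_of_notMem _ _ _ _ u ?_
    rintro ⟨l, hl⟩
    have h1 := congrArg (· % (p : ℤ)) hl
    simp only [Int.add_mul_emod_self_left] at h1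
    rw [Int.emod_eq_of_lt (by omega) (by omega), Int.emod_eq_of_lt (by omega) (by omega)] at h1
    exact h (Fin.ext (by omega))

theorem lpResidue_mul_adjoint (i j : Fin p) :
    lpResidue i * ContinuousLinearMap.adjoint (lpResidue j) = if i = j then 1 else 0 := by
  ext u k
  rw [mul_apply_eq_comp, lpResidue_apply, adjoint_lpResidue_apply]
  split_ifs <;> rfl

theorem sum_adjoint_mul_lpResidue (hp : 1 ≤ p) :
    ∑ i : Fin p, ContinuousLinearMap.adjoint (lpResidue i) * lpResidue i = 1 := by
  ext u n
  obtain ⟨m, k, rfl⟩ := exists_eq_residue hp n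
  rw [_root_.sum_apply, lp.coeFn_sum, Finset.sum_apply]
  simp [adjoint_lpResidue_apply, lpResidue_apply]

end Residue

section Symbol

variable {p : ℕ}

/-- The tridiagonal part of the symbol matrix. -/
noncomputable def symbolDiag (p : ℕ) (a b c : ℤ → ℝ) : Matrix (Fin p) (Fin p) ℂ :=
  Matrix.of fun i j =>
    (if (i : ℕ) = (j : ℕ) then (a ((i : ℕ) : ℤ) : ℂ) else 0)
    + (if (j : ℕ) = (i : ℕ) + 1 then (b ((i : ℕ) : ℤ) : ℂ) else 0)
    + (if (i : ℕ) = (j : ℕ) + 1 then (c ((j : ℕ) : ℤ) : ℂ) else 0)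

/-- The coefficient of `e^{iθ}` in the symbol matrix. -/
noncomputable def symbolForward (p : ℕ) (b : ℤ → ℝ) : Matrix (Fin p) (Fin p) ℂ :=
  Matrix.of fun i j => if (i : ℕ) = p - 1 ∧ (j : ℕ) = 0 then (b ((p : ℤ) - 1) : ℂ) else 0

/-- The coefficient of `e^{-iθ}` in the symbol matrix. -/
noncomputable def symbolBackward (p : ℕ) (c : ℤ → ℝ) : Matrix (Fin p) (Fin p) ℂ :=
  Matrix.of fun i j => if (i : ℕ) = 0 ∧ (j : ℕ) = p - 1 then (c ((p : ℤ) - 1) : ℂ) else 0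

theorem symbolMat_eq_matrixPencil (a b c : ℤ → ℝ) (θ : ℝ) :
    symbolMat p a b c θ = matrixPencil (symbolDiag p a b c) (symbolForward p b)
      (symbolBackward p c) 1 (Complex.exp (θ * Complex.I)) (Complex.exp (θ * Complex.I))⁻¹ := by
  ext i j
  simp [symbolMat, matrixPencil, symbolDiag, symbolForward, symbolBackward, ← Complex.exp_neg]
  ring

theorem periodic_mul_add {f : ℤ → ℝ} (hf : ∀ n : ℤ, f (n + p) = f n) (n k : ℤ) :
    f (n + p * k) = f n := by
  have h : Function.Periodic f (p : ℤ) := hf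
  simpa [mul_comm] using h.int_mul k n

theorem lpResidue_mul_jacobi_mul_adjoint (a b c : ℤ → ℝ)
    (ha : ∀ n : ℤ, a (n + p) = a n) (hb : ∀ n : ℤ, b (n + p) = b n)
    (hc : ∀ n : ℤ, c (n + p) = c n)
    (J : lp (fun _ : ℤ => ℂ) 2 →L[ℂ] lp (fun _ : ℤ => ℂ) 2)
    (hJ : ∀ u : lp (fun _ : ℤ => ℂ) 2, ∀ n : ℤ,
      J u n = (c (n - 1) : ℂ) * u (n - 1) + (a n : ℂ) * u n + (b n : ℂ) * u (n + 1))
    (i j : Fin p) :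
    lpResidue i * J * ContinuousLinearMap.adjoint (lpResidue j) =
      matrixPencil (symbolDiag p a b c) (symbolForward p b) (symbolBackward p c)
        1 lpShift lpShiftInv i j := by
  ext u k
  have hi := i.isLt
  have hj := j.isLt
  have hL : (c (i + p * k - 1) : ℂ) *
      ContinuousLinearMap.adjoint (lpResidue j) u (i + p * k - 1) =
      (if (i : ℕ) = j + 1 then (c (j : ℕ) : ℂ) else 0) * u k +
      (if (i : ℕ) = 0 ∧ (j : ℕ) = p - 1 then (c ((p : ℤ) - 1) : ℂ) else 0) * u (k - 1) := by
    by_cases h : (i : ℕ) = 0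
    · have e : (i : ℤ) + p * k - 1 = ((⟨p - 1, by omega⟩ : Fin p) : ℕ) + p * (k - 1) := by
        push_cast [Nat.cast_sub (show 1 ≤ p by omega), h]; ring
      rw [e, adjoint_lpResidue_apply, periodic_mul_add hc]
      have : (((p - 1 : ℕ) : ℤ)) = (p : ℤ) - 1 := by omega
      simp [h, Fin.ext_iff, eq_comm, this]
    · have e : (i : ℤ) + p * k - 1 = ((⟨i - 1, by omega⟩ : Fin p) : ℕ) + p * k := by
        push_cast [Nat.cast_sub (show 1 ≤ (i : ℕ) by omega)]; ring
      rw [e, adjoint_lpResidue_apply, periodic_mul_add hc]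
      by_cases hij : (i : ℕ) = j + 1
      · simp [hij]
      · have : ¬ (i : ℕ) - 1 = j := by omega
        simp [h, hij, Fin.ext_iff, this]
  have hR : (b (i + p * k) : ℂ) *
      ContinuousLinearMap.adjoint (lpResidue j) u (i + p * k + 1) =
      (if (j : ℕ) = i + 1 then (b (i : ℕ) : ℂ) else 0) * u k +
      (if (i : ℕ) = p - 1 ∧ (j : ℕ) = 0 then (b ((p : ℤ) - 1) : ℂ) else 0) * u (k + 1) := by
    rw [periodic_mul_add hb]
    by_cases h : (i : ℕ) = p - 1
    · have hip : (i : ℤ) = p - 1 := by omega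
      have e : (i : ℤ) + p * k + 1 = ((⟨0, by omega⟩ : Fin p) : ℕ) + p * (k + 1) := by
        rw [hip]; push_cast; ring
      have : ¬ (j : ℕ) = i + 1 := by omega
      rw [e, adjoint_lpResidue_apply, hip, if_neg this]
      simp [h, Fin.ext_iff, eq_comm]
    · have e : (i : ℤ) + p * k + 1 = ((⟨i + 1, by omega⟩ : Fin p) : ℕ) + p * k := by
        push_cast; ring
      rw [e, adjoint_lpResidue_apply]
      simp [h, Fin.ext_iff, eq_comm]
  have hM : (a (i + p * k) : ℂ) * ContinuousLinearMap.adjoint (lpResidue j) u (i + p * k) =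
      (if (i : ℕ) = j then (a (i : ℕ) : ℂ) else 0) * u k := by
    rw [periodic_mul_add ha, adjoint_lpResidue_apply]
    simp [Fin.ext_iff]
  rw [mul_apply_eq_comp, mul_apply_eq_comp, lpResidue_apply, hJ, hL, hM,
    hR]
  change _ = symbolDiag p a b c i j * u k + symbolForward p b i j * lpShift u k +
    symbolBackward p c i j * lpShiftInv u k
  simp only [symbolDiag, symbolForward, symbolBackward, Matrix.of_apply, lpShift_apply,
    lpShiftInv_apply]
  ring

end Symbol

theorem spectrum_jacobi_eq_iUnion_spectrum_symbol
    (p : ℕ) (hp : 1 ≤ p) (a b c : ℤ → ℝ)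
    (ha : ∀ n : ℤ, a (n + p) = a n) (hb : ∀ n : ℤ, b (n + p) = b n)
    (hc : ∀ n : ℤ, c (n + p) = c n)
    (J : lp (fun _ : ℤ => ℂ) 2 →L[ℂ] lp (fun _ : ℤ => ℂ) 2)
    (hJ : ∀ u : lp (fun _ : ℤ => ℂ) 2, ∀ n : ℤ,
      J u n = (c (n - 1) : ℂ) * u (n - 1) + (a n : ℂ) * u n + (b n : ℂ) * u (n + 1)) :
    spectrum ℂ J =
      ⋃ θ ∈ Set.Ioc (-Real.pi) Real.pi, spectrum ℂ (symbolMat p a b c θ) := by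
  let Ψ := cuntzEquiv (fun j : Fin p => ContinuousLinearMap.adjoint (lpResidue j)) lpResidue
    lpResidue_mul_adjoint (sum_adjoint_mul_lpResidue hp)
  have hΨ : Ψ J = matrixPencil (symbolDiag p a b c) (symbolForward p b) (symbolBackward p c)
      1 lpShift lpShiftInv :=
    Matrix.ext (lpResidue_mul_jacobi_mul_adjoint a b c ha hb hc J hJ)
  ext z
  rw [← AlgEquiv.spectrum_eq Ψ J, hΨ, spectrum.mem_iff, algebraMap_sub_matrixPencil,
    isUnit_matrixPencil_iff_forall_mem_spectrum _ _ _ lpShift_mul_lpShiftInv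
      lpShiftInv_mul_lpShift (spectrum.nonempty _)]
  simp only [mem_spectrum_lpShift]
  simp only [Set.mem_iUnion, spectrum.mem_iff, symbolMat_eq_matrixPencil,
    algebraMap_sub_matrixPencil]
  push Not
  constructor
  · rintro ⟨w, hw, h⟩
    refine ⟨w.arg, Complex.arg_mem_Ioc w, ?_⟩
    have hexp : Complex.exp (w.arg * Complex.I) = w := by
      have := Complex.norm_mul_exp_arg_mul_I w
      rwa [hw, Complex.ofReal_one, one_mul] at this
    rwa [hexp]
  · rintro ⟨θ, -, h⟩
    exact ⟨_, Complex.norm_exp_ofReal_mul_I θ, h⟩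
end

section
/- Let p ≥ 2, let a : ℤ → ℝ be a p-periodic sequence with ω_a > 0, and let b, c ∈ ℝ. Let J be the bounded linear operator on ℓ²(ℤ) defined by (Ju)_n = c·u_{n−1} + a_n·u_n + b·u_{n+1} (the periodic Jacobi operator with constant off-diagonal sequences b_i = b, c_i = c). Then the ε-pseudospectrum Λ_{ω_a}(J) with ε = ω_a is a path-connected subset of ℂ. -/
/-- The `ε`-pseudospectrum of an element `a` of a complex normed algebra:
the set of `z ∈ ℂ` such that `z - a` is not invertible or `‖(z - a)⁻¹‖ ≥ ε⁻¹`. -/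
noncomputable def pseudospectrum {A : Type*} [NormedRing A] [NormedAlgebra ℂ A]
    (ε : ℝ) (a : A) : Set ℂ :=
  {z : ℂ | z ∈ spectrum ℂ a ∨ ε⁻¹ ≤ ‖Ring.inverse (algebraMap ℂ A z - a)‖}

/-- The oscillation `ω_v = max { |v i - v j| : 0 ≤ i, j ≤ p-1 }` of a `p`-periodic
real sequence `v`. -/
noncomputable def osc (p : ℕ) (v : ℤ → ℝ) : ℝ :=
  ⨆ i : Fin p, ⨆ j : Fin p, |v ((i : ℕ) : ℤ) - v ((j : ℕ) : ℤ)|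

open Set Filter Topology

lemma disjoint_frontier_connectedComponentIn {X : Type*} [TopologicalSpace X]
    [LocallyConnectedSpace X] {F : Set X} (hF : IsOpen F) (x : X) :
    Disjoint (frontier (connectedComponentIn F x)) F := by
  rw [Set.disjoint_left]
  intro y hy hyF
  rw [hF.connectedComponentIn.frontier_eq] at hy
  have hmem := connectedComponentIn_mem_nhds (hF.mem_nhds hyF)
  obtain ⟨w, hwy, hwx⟩ := mem_closure_iff_nhds.1 hy.1 _ hmem
  apply hy.2
  rw [connectedComponentIn_eq hwx, ← connectedComponentIn_eq hwy]
  exact mem_connectedComponentIn hyF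

/-- A holomorphic function which is nonzero and not locally constant at `z₀` strictly increases in
modulus along some segment issuing from `z₀`. -/
lemma AnalyticAt.exists_norm_lt_on_segment {h : ℂ → ℂ} {z₀ : ℂ} (hh : AnalyticAt ℂ h z₀)
    (h0 : h z₀ ≠ 0) (hc : ¬ ∀ᶠ z in 𝓝 z₀, h z = h z₀) :
    ∃ w : ℂ, ∀ᶠ r : ℝ in 𝓝[>] 0, ‖h z₀‖ < ‖h (z₀ + r * w)‖ := by
  have hf : AnalyticAt ℂ (fun z => h z - h z₀) z₀ := hh.sub analyticAt_const
  have hne : ¬ ∀ᶠ z in 𝓝 z₀, h z - h z₀ = 0 := by simpa only [sub_eq_zero] using hc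
  obtain ⟨n, g, hg, hg0, heq⟩ := hf.exists_eventuallyEq_pow_smul_nonzero_iff.2 hne
  have hn : n ≠ 0 := by
    rintro rfl
    have := heq.self_of_nhds
    simp at this
    exact hg0 this.symm
  obtain ⟨w, hw⟩ := IsAlgClosed.exists_pow_nat_eq (h z₀ / g z₀) (Nat.pos_of_ne_zero hn)
  refine ⟨w, ?_⟩
  have hcont : Tendsto (fun r : ℝ => z₀ + r * w) (𝓝[>] 0) (𝓝 z₀) := by
    have : Continuous (fun r : ℝ => z₀ + r * w) := by fun_prop
    simpa using (this.tendsto 0).mono_left nhdsWithin_le_nhds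
  have hq : Tendsto (fun r : ℝ => (g (z₀ + r * w) / g z₀).re) (𝓝[>] 0) (𝓝 1) := by
    have := (Complex.continuous_re.tendsto _).comp
      ((hg.continuousAt.tendsto.comp hcont).div_const (g z₀))
    simpa [div_self hg0, Function.comp_def] using this
  filter_upwards [hcont.eventually heq, hq.eventually (lt_mem_nhds zero_lt_one),
    self_mem_nhdsWithin] with r h1 h2 hr
  have hr : 0 < r := hr
  have key : h (z₀ + r * w) = h z₀ * (1 + (r ^ n : ℝ) * (g (z₀ + r * w) / g z₀)) := by
    have : h (z₀ + r * w) = h z₀ + (r * w) ^ n * g (z₀ + r * w) := by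
      rw [smul_eq_mul, add_sub_cancel_left] at h1
      rw [← h1]; ring
    rw [this, mul_pow, hw]
    push_cast
    field_simp
  rw [key, norm_mul]
  refine lt_mul_of_one_lt_right (norm_pos_iff.2 h0) (lt_of_lt_of_le ?_ (Complex.re_le_norm _))
  rw [Complex.add_re, Complex.re_ofReal_mul, Complex.one_re]
  have := mul_pos (pow_pos hr n) h2
  linarith

section BanachAlgebra

variable {A : Type*} [NormedRing A] [NormedAlgebra ℂ A] [CompleteSpace A] [NormOneClass A]

omit [NormedAlgebra ℂ A] in
lemma isUnit_of_norm_sub_mul_norm_inverse_lt {x y : A} (hx : IsUnit x)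
    (h : ‖y - x‖ * ‖Ring.inverse x‖ < 1) : IsUnit y := by
  obtain ⟨u, rfl⟩ := hx
  rw [Ring.inverse_unit] at h
  have : Nontrivial A := NormOneClass.nontrivial (G := A)
  have hpos : 0 < ‖(↑u⁻¹ : A)‖ := norm_pos_iff.2 u⁻¹.ne_zero
  refine ⟨u.ofNearby y ?_, rfl⟩
  rwa [← one_div, lt_div_iff₀ hpos]

lemma one_le_norm_sub_mul_norm_resolvent {a : A} {z w : ℂ} (hz : z ∉ spectrum ℂ a)
    (hw : w ∈ spectrum ℂ a) : 1 ≤ ‖w - z‖ * ‖resolvent a z‖ := by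
  by_contra! h
  refine hw (isUnit_of_norm_sub_mul_norm_inverse_lt (spectrum.notMem_iff.1 hz) ?_)
  rw [sub_sub_sub_cancel_right, ← map_sub, norm_algebraMap']
  exact h

omit [NormOneClass A] in
lemma differentiableAt_resolvent {a : A} {z : ℂ} (hz : z ∉ spectrum ℂ a) :
    DifferentiableAt ℂ (resolvent a) z :=
  (spectrum.hasDerivAt_resolvent_const_left (by simpa [spectrum] using hz)).differentiableAt

lemma isOpen_strict_pseudospectrum {ε : ℝ} (hε : 0 < ε) (a : A) :
    IsOpen {z : ℂ | z ∈ spectrum ℂ a ∨ ε⁻¹ < ‖resolvent a z‖} := by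
  rw [isOpen_iff_mem_nhds]
  intro z hz
  by_cases hs : z ∈ spectrum ℂ a
  · filter_upwards [Metric.ball_mem_nhds z hε] with w hw
    by_cases hw' : w ∈ spectrum ℂ a
    · exact Or.inl hw'
    · right
      have h1 := one_le_norm_sub_mul_norm_resolvent hw' hs
      rw [mem_ball_iff_norm'] at hw
      by_contra! h2
      have h3 : ‖z - w‖ * ‖resolvent a w‖ ≤ ‖z - w‖ * ε⁻¹ := by gcongr
      have h4 : ‖z - w‖ * ε⁻¹ < ε * ε⁻¹ := by gcongr
      rw [mul_inv_cancel₀ hε.ne'] at h4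
      linarith
  · have hz := hz.resolve_left hs
    filter_upwards [(differentiableAt_resolvent hs).continuousAt.norm.eventually
      (lt_mem_nhds hz)] with w hw
    exact Or.inr hw

omit [NormOneClass A] in
lemma isBounded_pseudospectrum {ε : ℝ} (hε : 0 < ε) (a : A) :
    Bornology.IsBounded (pseudospectrum ε a) := by
  have h := (spectrum.resolvent_tendsto_cobounded (𝕜 := ℂ) a).norm
  rw [norm_zero] at h
  have h1 : Bornology.IsBounded {z : ℂ | ¬ ‖resolvent a z‖ < ε⁻¹} :=
    Bornology.isBounded_def.2 (by
      filter_upwards [h.eventually (gt_mem_nhds (inv_pos.2 hε))] with z hz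
      simpa using hz)
  refine ((spectrum.isBounded a).union h1).subset ?_
  rintro z (hz | hz)
  · exact Or.inl hz
  · exact Or.inr (not_lt.2 hz)

lemma exists_joinedIn_spectrum_of_lt {ε : ℝ} (hε : 0 < ε) {a : A} {z : ℂ}
    (hz : ε⁻¹ < ‖resolvent a z‖) :
    ∃ w ∈ spectrum ℂ a, JoinedIn (pseudospectrum ε a) z w := by
  set V := {z : ℂ | z ∈ spectrum ℂ a ∨ ε⁻¹ < ‖resolvent a z‖} with hVdef
  have hV : IsOpen V := isOpen_strict_pseudospectrum hε a
  have hVP : V ⊆ pseudospectrum ε a := fun w hw => hw.imp id le_of_lt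
  have hzV : z ∈ V := Or.inr hz
  set W := connectedComponentIn V z
  have hzW : z ∈ W := mem_connectedComponentIn hzV
  have hWV : W ⊆ V := connectedComponentIn_subset V z
  have hW : IsOpen W := hV.connectedComponentIn
  obtain ⟨w, hwW, hws⟩ : ∃ w ∈ W, w ∈ spectrum ℂ a := by
    by_contra! hcon
    have hfr : ∀ y ∈ frontier W, y ∉ V := fun y hy =>
      Set.disjoint_left.1 (disjoint_frontier_connectedComponentIn hV z) hy
    have hcl : ∀ y ∈ closure W, y ∉ spectrum ℂ a := by
      intro y hy
      by_cases hyW : y ∈ W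
      · exact hcon y hyW
      · exact fun hs => hfr y (by rw [hW.frontier_eq]; exact ⟨hy, hyW⟩) (Or.inl hs)
    have hd : DiffContOnCl ℂ (resolvent a) W := by
      refine ⟨fun y hy => (differentiableAt_resolvent (hcon y hy)).differentiableWithinAt,
        fun y hy => (differentiableAt_resolvent (hcl y hy)).continuousAt.continuousWithinAt⟩
    have := Complex.norm_le_of_forall_mem_frontier_norm_le
      ((isBounded_pseudospectrum hε a).subset (hWV.trans hVP)) hd
      (C := ε⁻¹) (fun y hy => not_lt.1 fun h => hfr y hy (Or.inr h)) (subset_closure hzW)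
    exact this.not_gt hz
  have hpc : IsPathConnected W :=
    hW.isConnected_iff_isPathConnected.1 (isConnected_connectedComponentIn_iff.2 hzV)
  exact ⟨w, hws, (hpc.joinedIn z hzW w hwW).mono (hWV.trans hVP)⟩

lemma exists_joinedIn_spectrum {ε : ℝ} (hε : 0 < ε) {a : A} {z : ℂ}
    (hz : z ∈ pseudospectrum ε a) :
    ∃ w ∈ spectrum ℂ a, JoinedIn (pseudospectrum ε a) z w := by
  by_cases hs : z ∈ spectrum ℂ a
  · exact ⟨z, hs, JoinedIn.refl hz⟩
  have hnorm : ε⁻¹ ≤ ‖resolvent a z‖ := hz.resolve_left hs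
  rcases hnorm.lt_or_eq with hlt | heq
  · exact exists_joinedIn_spectrum_of_lt hε hlt
  suffices h : ∃ y, JoinedIn (pseudospectrum ε a) z y ∧ ε⁻¹ < ‖resolvent a y‖ by
    obtain ⟨y, hzy, hy⟩ := h
    obtain ⟨w, hw, hyw⟩ := exists_joinedIn_spectrum_of_lt hε hy
    exact ⟨w, hw, hzy.trans hyw⟩
  have hRz : resolvent a z ≠ 0 := norm_pos_iff.1 (heq ▸ inv_pos.2 hε)
  obtain ⟨φ, hφ, hφz⟩ := exists_dual_vector ℂ (resolvent a z) (norm_ne_zero_iff.2 hRz)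
  set h : ℂ → ℂ := fun y => φ (resolvent a y)
  have hh : DifferentiableOn ℂ h (spectrum ℂ a)ᶜ := fun y hy =>
    (φ.differentiableAt.comp y (differentiableAt_resolvent hy)).differentiableWithinAt
  have hopen : IsOpen (spectrum ℂ a)ᶜ := (spectrum.isClosed a).isOpen_compl
  have han := hh.analyticOnNhd hopen
  have hle : ∀ y, ‖h y‖ ≤ ‖resolvent a y‖ := fun y => by
    simpa [hφ] using φ.le_opNorm (resolvent a y)
  have hhz : ‖h z‖ = ε⁻¹ := by
    simp only [h, hφz, heq]; simp
  by_cases hc : ∀ᶠ y in 𝓝 z, h y = h z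
  · set U := connectedComponentIn (spectrum ℂ a)ᶜ z
    have hzU : z ∈ U := mem_connectedComponentIn hs
    have hU : IsOpen U := hopen.connectedComponentIn
    have hUs : U ⊆ (spectrum ℂ a)ᶜ := connectedComponentIn_subset _ _
    have hconst : EqOn h (fun _ => h z) U :=
      (han.mono hUs).eqOn_of_preconnected_of_eventuallyEq analyticOnNhd_const
        isPreconnected_connectedComponentIn hzU hc
    have hUP : U ⊆ pseudospectrum ε a := fun y hy =>
      Or.inr (by rw [← hhz, ← show h y = h z from hconst hy]; exact hle y)
    have : Nontrivial A := NormOneClass.nontrivial (G := A)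
    obtain ⟨s, hs'⟩ := spectrum.nonempty a
    have hfr : (frontier U).Nonempty := by
      rw [nonempty_frontier_iff]
      exact ⟨⟨z, hzU⟩, fun hu => hUs (hu ▸ mem_univ s) hs'⟩
    obtain ⟨x, hx⟩ := hfr
    have hxs : x ∈ spectrum ℂ a := by
      by_contra hx'
      exact Set.disjoint_left.1 (disjoint_frontier_connectedComponentIn hopen z) hx hx'
    obtain ⟨y, hyV, hyU⟩ := mem_closure_iff_nhds.1 (frontier_subset_closure hx) _
      ((isOpen_strict_pseudospectrum hε a).mem_nhds (Or.inl hxs))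
    have hpc : IsPathConnected U :=
      hU.isConnected_iff_isPathConnected.1 (isConnected_connectedComponentIn_iff.2 hs)
    exact ⟨y, (hpc.joinedIn z hzU y hyU).mono hUP, hyV.resolve_left (hUs hyU)⟩
  · have h0 : h z ≠ 0 := norm_pos_iff.1 (hhz ▸ inv_pos.2 hε)
    obtain ⟨w, hw⟩ := (han z hs).exists_norm_lt_on_segment h0 hc
    obtain ⟨δ, hδ, hδw⟩ := mem_nhdsGT_iff_exists_Ioc_subset.1 hw
    have hδ : 0 < δ := hδ
    refine ⟨z + δ * w, JoinedIn.of_segment_subset ?_, ?_⟩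
    · rw [segment_eq_image']
      rintro _ ⟨t, ⟨ht0, ht1⟩, rfl⟩
      rcases ht0.eq_or_lt with rfl | ht
      · simpa using hz
      · have hlt : ‖h z‖ < ‖h (z + (t * δ : ℝ) * w)‖ :=
          hδw (show t * δ ∈ Ioc 0 δ from ⟨by positivity, by nlinarith⟩)
        refine Or.inr (?_ : ε⁻¹ ≤ ‖resolvent a _‖)
        refine (hhz.symm.le.trans hlt.le).trans ((hle _).trans (le_of_eq ?_))
        simp [mul_assoc]
    · have hlt : ‖h z‖ < ‖h (z + δ * w)‖ := hδw (right_mem_Ioc.2 hδ)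
      exact (hhz.symm.trans_lt hlt).trans_le (hle _)

theorem isPathConnected_pseudospectrum {ε : ℝ} (hε : 0 < ε) {a : A} {N : Set ℂ}
    (hN : IsPathConnected N) (hsN : spectrum ℂ a ⊆ N) (hNP : N ⊆ pseudospectrum ε a) :
    IsPathConnected (pseudospectrum ε a) := by
  obtain ⟨x, hx, hxN⟩ := hN
  refine ⟨x, hNP hx, fun {z} hz => ?_⟩
  obtain ⟨w, hw, hzw⟩ := exists_joinedIn_spectrum hε hz
  exact ((hxN (hsN hw)).mono hNP).trans hzw.symm

end BanachAlgebra

section CStarAlgebra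

variable {A : Type*} [CStarAlgebra A]

lemma norm_resolvent_lt_of_isStarNormal {t : A} [IsStarNormal t] {z : ℂ} {δ : ℝ} (hδ : 0 < δ)
    (h : ∀ w ∈ spectrum ℂ t, δ < ‖z - w‖) : ‖resolvent t z‖ < δ⁻¹ := by
  have hne : ∀ w ∈ spectrum ℂ t, z - w ≠ 0 := fun w hw => norm_pos_iff.1 (hδ.trans (h w hw))
  have hcfc : resolvent t z = cfc (fun w => (z - w)⁻¹) t := by
    rw [cfc_inv (fun w => z - w) t hne, cfc_sub _ _ t, cfc_const z t, cfc_id' ℂ t]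
    rfl
  rw [hcfc]
  refine norm_cfc_lt (inv_pos.2 hδ) fun w hw => ?_
  rw [norm_inv]
  exact inv_strictAnti₀ hδ (h w hw)

/-- If `x` lies within `ε / 2` of a normal element with path-connected spectrum, then the
`ε`-pseudospectrum of `x` is path-connected. -/
theorem isPathConnected_pseudospectrum_of_norm_sub_le [Nontrivial A] {t x : A} [IsStarNormal t]
    (ht : IsPathConnected (spectrum ℂ t)) {ε : ℝ} (hε : 0 < ε) (hx : ‖x - t‖ ≤ ε / 2) :
    IsPathConnected (pseudospectrum ε x) := by
  refine isPathConnected_pseudospectrum hε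
    (N := {z | ∃ w ∈ spectrum ℂ t, ‖z - w‖ ≤ ε / 2}) ?_ ?_ ?_
  · obtain ⟨w₀, hw₀, hjoin⟩ := ht
    refine ⟨w₀, ⟨w₀, hw₀, by simpa using (half_pos hε).le⟩, ?_⟩
    rintro z ⟨w, hw, hzw⟩
    refine ((hjoin hw).mono fun v hv => show ∃ w ∈ spectrum ℂ t, ‖v - w‖ ≤ ε / 2 from
      ⟨v, hv, by simpa using (half_pos hε).le⟩).trans
      (JoinedIn.of_segment_subset ?_)
    intro v hv
    refine ⟨w, hw, ?_⟩
    rw [← mem_closedBall_iff_norm] at hzw ⊢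
    exact (convex_closedBall w (ε / 2)).segment_subset
      (Metric.mem_closedBall_self (half_pos hε).le) hzw hv
  · intro z hz
    by_contra! hcon
    simp only [mem_ofPred_eq, not_exists, not_and, not_le] at hcon
    have hzt : z ∉ spectrum ℂ t := fun h => by
      have := hcon z h
      rw [sub_self, norm_zero] at this
      linarith
    have hR := norm_resolvent_lt_of_isStarNormal (half_pos hε) hcon
    refine hz (isUnit_of_norm_sub_mul_norm_inverse_lt (spectrum.notMem_iff.1 hzt) ?_)
    rw [sub_sub_sub_cancel_left, norm_sub_rev]
    calc ‖x - t‖ * ‖resolvent t z‖ ≤ ε / 2 * ‖resolvent t z‖ := by gcongr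
      _ < ε / 2 * (ε / 2)⁻¹ := by gcongr
      _ = 1 := mul_inv_cancel₀ (half_pos hε).ne'
  · rintro z ⟨w, hw, hzw⟩
    by_contra hcon
    obtain ⟨hzx, hR⟩ := not_or.1 hcon
    rw [not_le] at hR
    refine hw (isUnit_of_norm_sub_mul_norm_inverse_lt (spectrum.notMem_iff.1 hzx) ?_)
    have hnorm : ‖(algebraMap ℂ A w - t) - (algebraMap ℂ A z - x)‖ ≤ ε := by
      rw [show (algebraMap ℂ A w - t) - (algebraMap ℂ A z - x)
        = (x - t) - algebraMap ℂ A (z - w) by rw [map_sub]; abel]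
      refine (norm_sub_le _ _).trans ?_
      rw [norm_algebraMap']
      linarith
    calc _ ≤ ε * ‖Ring.inverse (algebraMap ℂ A z - x)‖ := by gcongr
      _ < ε * ε⁻¹ := by gcongr
      _ = 1 := mul_inv_cancel₀ hε.ne'

lemma cfc_symbol (s : A) [IsStarNormal s] (b c μ : ℂ) :
    cfc (fun z => b * z + c * star z + μ) s = b • s + c • star s + algebraMap ℂ A μ := by
  rw [cfc_add s (fun z => b * z + c * star z) (fun _ => μ),
    cfc_add s (fun z => b * z) (fun z => c * star z), cfc_const_mul b (fun z => z) s,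
    cfc_const_mul c (fun z => star z) s, cfc_id' ℂ s, cfc_star_id s, cfc_const μ s]

end CStarAlgebra

section BilateralShift

open scoped ENNReal

local notation "ℓ²ℤ" => lp (fun _ : ℤ => ℂ) 2

lemma memℓp_comp_equiv {ι : Type*} (e : ι ≃ ι) (u : lp (fun _ : ι => ℂ) 2) :
    Memℓp (fun n => u (e n)) 2 := by
  have h := lp.memℓp u
  rw [memℓp_gen_iff (by simp)] at h ⊢
  exact e.summable_iff.2 h

/-- Reindexing of square-summable families by a permutation, as a linear isometry. -/
noncomputable def lpReindex {ι : Type*} (e : ι ≃ ι) :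
    lp (fun _ : ι => ℂ) 2 ≃ₗᵢ[ℂ] lp (fun _ : ι => ℂ) 2 where
  toFun u := ⟨fun n => u (e n), memℓp_comp_equiv e u⟩
  invFun u := ⟨fun n => u (e.symm n), memℓp_comp_equiv e.symm u⟩
  map_add' u v := rfl
  map_smul' r u := rfl
  left_inv u := by ext n; simp
  right_inv u := by ext n; simp
  norm_map' u := by
    rw [lp.norm_eq_tsum_rpow (by simp), lp.norm_eq_tsum_rpow (by simp)]
    congr 1
    exact e.tsum_eq (fun n => ‖u n‖ ^ (2 : ℝ≥0∞).toReal)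

/-- The bilateral shift `(S u) n = u (n + 1)` on `ℓ²(ℤ)`. -/
noncomputable def bilateralShift : unitary (ℓ²ℤ →L[ℂ] ℓ²ℤ) :=
  Unitary.linearIsometryEquiv.symm (lpReindex (Equiv.addRight (1 : ℤ)))

lemma bilateralShift_apply (u : ℓ²ℤ) (n : ℤ) :
    (bilateralShift : ℓ²ℤ →L[ℂ] ℓ²ℤ) u n = u (n + 1) := rfl

lemma star_bilateralShift_apply (u : ℓ²ℤ) (n : ℤ) :
    star (bilateralShift : ℓ²ℤ →L[ℂ] ℓ²ℤ) u n = u (n - 1) := by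
  have h : star bilateralShift =
      Unitary.linearIsometryEquiv.symm (lpReindex (Equiv.addRight (1 : ℤ))).symm := by
    rw [Unitary.star_eq_inv, bilateralShift, ← map_inv]
    rfl
  rw [← Unitary.coe_star, h]
  rfl

instance : Nontrivial ℓ²ℤ :=
  ⟨lp.single 2 0 1, 0, fun h => by simpa using congrArg (fun u : ℓ²ℤ => u 0) h⟩

lemma lp_tendsto_cofinite (u : ℓ²ℤ) : Tendsto (fun n => ‖u n‖) cofinite (𝓝 0) := by
  have h := ((lp.memℓp u).summable (by simp)).tendsto_cofinite_zero
  have h2 := (Real.continuous_sqrt.tendsto 0).comp h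
  simpa [Function.comp_def] using h2

lemma spectrum_bilateralShift :
    spectrum ℂ (bilateralShift : ℓ²ℤ →L[ℂ] ℓ²ℤ) = Metric.sphere 0 1 := by
  refine (Unitary.spectrum_subset_circle bilateralShift).antisymm fun ζ hζ hunit => ?_
  have hζ : ‖ζ‖ = 1 := by simpa using hζ
  obtain ⟨r, hr⟩ := hunit.exists_right_inv
  set u : ℓ²ℤ := r (lp.single 2 0 1) with hu
  have hu_eq : ∀ n : ℤ, ζ * u n - u (n + 1) = (Pi.single 0 1 : ℤ → ℂ) n := by
    intro n
    have h1 := congrArg (fun T : ℓ²ℤ →L[ℂ] ℓ²ℤ => T (lp.single 2 0 1) n) hr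
    exact h1
  have hstep : ∀ n : ℤ, n ≠ 0 → ‖u (n + 1)‖ = ‖u n‖ := by
    intro n hn
    have := hu_eq n
    rw [Pi.single_eq_of_ne hn, sub_eq_zero] at this
    rw [← this, norm_mul, hζ, one_mul]
  have hright : ∀ k : ℕ, ‖u (k + 1)‖ = ‖u 1‖ := by
    intro k
    induction k with
    | zero => simp
    | succ k ih => rw [← ih, ← hstep (k + 1) (by omega)]; push_cast; rfl
  have hleft : ∀ k : ℕ, ‖u (-k)‖ = ‖u 0‖ := by
    intro k
    induction k with
    | zero => simp
    | succ k ih => rw [← ih, ← hstep (-(k + 1 : ℕ)) (by omega), Nat.cast_succ, neg_add_rev,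
      neg_add_cancel_comm]
  have hlim := lp_tendsto_cofinite u
  have h1 : ‖u 1‖ = 0 := by
    have hinj : Function.Injective (fun k : ℕ => (k + 1 : ℤ)) := fun i j h => by simpa using h
    have := hlim.comp hinj.tendsto_cofinite
    simp only [Function.comp_def, hright] at this
    exact tendsto_nhds_unique tendsto_const_nhds this
  have h0 : ‖u 0‖ = 0 := by
    have hinj : Function.Injective (fun k : ℕ => (-k : ℤ)) := fun i j h => by simpa using h
    have := hlim.comp hinj.tendsto_cofinite
    simp only [Function.comp_def, hleft] at this
    exact tendsto_nhds_unique tendsto_const_nhds this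
  have := hu_eq 0
  rw [norm_eq_zero] at h0 h1
  simp [h0, h1] at this

/-- The Laurent operator on `ℓ²(ℤ)` with symbol `b z + c z⁻¹ + μ`. -/
noncomputable def laurent (b c μ : ℂ) : ℓ²ℤ →L[ℂ] ℓ²ℤ :=
  b • (bilateralShift : ℓ²ℤ →L[ℂ] ℓ²ℤ) + c • star (bilateralShift : ℓ²ℤ →L[ℂ] ℓ²ℤ)
    + algebraMap ℂ (ℓ²ℤ →L[ℂ] ℓ²ℤ) μ

lemma laurent_apply (b c μ : ℂ) (u : ℓ²ℤ) (n : ℤ) :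
    laurent b c μ u n = b * u (n + 1) + c * u (n - 1) + μ * u n := by
  rw [← bilateralShift_apply, ← star_bilateralShift_apply]
  rfl

lemma laurent_eq_cfc (b c μ : ℂ) :
    laurent b c μ =
      cfc (fun z => b * z + c * star z + μ) (bilateralShift : ℓ²ℤ →L[ℂ] ℓ²ℤ) :=
  (cfc_symbol _ b c μ).symm

instance isStarNormal_laurent (b c μ : ℂ) : IsStarNormal (laurent b c μ) := by
  rw [laurent_eq_cfc]
  exact cfc_predicate _ _

lemma isPathConnected_spectrum_laurent (b c μ : ℂ) :
    IsPathConnected (spectrum ℂ (laurent b c μ)) := by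
  rw [laurent_eq_cfc, cfc_map_spectrum _ (bilateralShift : ℓ²ℤ →L[ℂ] ℓ²ℤ), spectrum_bilateralShift]
  refine IsPathConnected.image ?_ (by fun_prop)
  exact isPathConnected_sphere (by rw [Complex.rank_real_complex]; norm_num) 0 zero_le_one

end BilateralShift

lemma abs_sub_le_osc (p : ℕ) (v : ℤ → ℝ) (i j : Fin p) :
    |v ((i : ℕ) : ℤ) - v ((j : ℕ) : ℤ)| ≤ osc p v :=
  (le_ciSup (f := fun j : Fin p => |v ((i : ℕ) : ℤ) - v ((j : ℕ) : ℤ)|)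
    (Set.finite_range _).bddAbove j).trans
  (le_ciSup (f := fun i : Fin p => ⨆ j : Fin p, |v ((i : ℕ) : ℤ) - v ((j : ℕ) : ℤ)|)
    (Set.finite_range _).bddAbove i)

lemma exists_forall_abs_sub_le_half_osc {p : ℕ} (hp : 0 < p) {v : ℤ → ℝ}
    (hv : ∀ n : ℤ, v (n + p) = v n) : ∃ μ : ℝ, ∀ n : ℤ, |v n - μ| ≤ osc p v / 2 := by
  have : Nonempty (Fin p) := ⟨⟨0, hp⟩⟩
  obtain ⟨i, hi⟩ := Finite.exists_max (fun i : Fin p => v ((i : ℕ) : ℤ))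
  obtain ⟨j, hj⟩ := Finite.exists_min (fun i : Fin p => v ((i : ℕ) : ℤ))
  refine ⟨(v ((i : ℕ) : ℤ) + v ((j : ℕ) : ℤ)) / 2, fun n => ?_⟩
  have hp' : (0 : ℤ) < p := by exact_mod_cast hp
  obtain ⟨k, hk⟩ : ∃ k : Fin p, v n = v ((k : ℕ) : ℤ) := by
    have h0 := Int.emod_nonneg n hp'.ne'
    have h1 := Int.emod_lt_of_pos n hp'
    refine ⟨⟨(n % p).toNat, by omega⟩, ?_⟩
    have hper : Function.Periodic v (p : ℤ) := hv
    have := hper.int_mul (n / p) (n % p)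
    simp only [Int.toNat_of_nonneg h0]
    rw [← this, mul_comm, Int.cast_id, Int.emod_add_mul_ediv]
  have h1 := (le_abs_self _).trans (abs_sub_le_osc p v i j)
  have h2 := hi k
  have h3 := hj k
  rw [hk, abs_le]
  constructor <;> linarith

theorem pseudospectrum_pathConnected_of_constant_offdiagonal
    (p : ℕ) (hp : 2 ≤ p) (a : ℤ → ℝ) (ha : ∀ n : ℤ, a (n + p) = a n)
    (hosc : 0 < osc p a) (b c : ℝ)
    (J : lp (fun _ : ℤ => ℂ) 2 →L[ℂ] lp (fun _ : ℤ => ℂ) 2)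
    (hJ : ∀ u : lp (fun _ : ℤ => ℂ) 2, ∀ n : ℤ,
      J u n = (c : ℂ) * u (n - 1) + (a n : ℂ) * u n + (b : ℂ) * u (n + 1)) :
    IsPathConnected (pseudospectrum (osc p a) J) := by
  obtain ⟨μ, hμ⟩ := exists_forall_abs_sub_le_half_osc (by omega) ha
  refine isPathConnected_pseudospectrum_of_norm_sub_le
    (isPathConnected_spectrum_laurent b c μ) hosc ?_
  have hpos : 0 ≤ osc p a / 2 := (half_pos hosc).le
  refine ContinuousLinearMap.opNorm_le_bound _ hpos fun u => ?_
  rw [← Real.norm_of_nonneg hpos, ← Complex.norm_real, ← norm_smul]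
  refine lp.norm_mono two_ne_zero fun n => ?_
  have key : (J - laurent b c μ) u n = ((a n - μ : ℝ) : ℂ) * u n := by
    change J u n - laurent b c μ u n = _
    rw [hJ, laurent_apply]
    push_cast
    ring
  rw [key, lp.coeFn_smul, Pi.smul_apply, smul_eq_mul, norm_mul, norm_mul, Complex.norm_real,
    Complex.norm_real, Real.norm_of_nonneg hpos]
  exact mul_le_mul_of_nonneg_right (hμ n) (norm_nonneg _)
end

section
/- Let p ≥ 2, let a : ℤ → ℝ be a p-periodic sequence, and let b, c ∈ ℝ. Let J be the bounded linear operator on ℓ²(ℤ) defined by (Ju)_n = c·u_{n−1} + a_n·u_n + b·u_{n+1}. If for some ε > 0 the ε-pseudospectrum Λ_ε(J) is path-connected, then ω_a ≤ 2(ε + |b − c|)(p − 1). -/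
/-- A bounded operator that is bounded below together with its adjoint is invertible. -/
theorem isUnit_of_bounded_below {H : Type*} [NormedAddCommGroup H] [InnerProductSpace ℂ H]
    [CompleteSpace H] {A : H →L[ℂ] H} {r : ℝ} (hr : 0 < r) (h : ∀ u, r * ‖u‖ ≤ ‖A u‖)
    (h' : ∀ u, r * ‖u‖ ≤ ‖A.adjoint u‖) : IsUnit A := by
  have key : ∀ B : H →L[ℂ] H, (∀ u, r * ‖u‖ ≤ ‖B u‖) → IsUnit (B.adjoint * B) := by
    intro B hB
    refine ContinuousLinearMap.isUnit_of_forall_le_norm_inner_map (𝕜 := ℂ) _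
      (c := ⟨r ^ 2, by positivity⟩)
      (by change (0 : ℝ) < r ^ 2; positivity) fun u => ?_
    rw [mul_apply_eq_comp, ContinuousLinearMap.adjoint_inner_left, inner_self_eq_norm_sq_to_K]
    have := pow_le_pow_left₀ (by positivity) (hB u) 2
    simp only [norm_pow, RCLike.norm_ofReal, abs_norm]
    change ‖u‖ ^ 2 * r ^ 2 ≤ ‖B u‖ ^ 2
    linarith [mul_pow r ‖u‖ 2]
  have h₁ := key A h
  have h₂ := key A.adjoint h'
  rw [ContinuousLinearMap.adjoint_adjoint] at h₂
  obtain ⟨P, hP⟩ := h₁.exists_left_inv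
  obtain ⟨Q, hQ⟩ := h₂.exists_right_inv
  exact isUnit_iff_exists_and_exists.2 ⟨⟨A.adjoint * Q, by rw [← mul_assoc, hQ]⟩,
    ⟨P * A.adjoint, by rw [mul_assoc, hP]⟩⟩

/-- The inverse of an operator bounded below by `r` has norm at most `r⁻¹`. -/
theorem norm_ringInverse_le {H : Type*} [NormedAddCommGroup H] [InnerProductSpace ℂ H]
    {A : H →L[ℂ] H} {r : ℝ} (hr : 0 < r) (hA : IsUnit A) (h : ∀ u, r * ‖u‖ ≤ ‖A u‖) :
    ‖Ring.inverse A‖ ≤ r⁻¹ := by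
  refine ContinuousLinearMap.opNorm_le_bound _ (by positivity) fun v => ?_
  have h₁ := h (Ring.inverse A v)
  rw [← mul_apply_eq_comp, Ring.mul_inverse_cancel _ hA, one_apply_eq_self] at h₁
  rw [inv_mul_eq_div, le_div_iff₀ hr]
  linarith

theorem tendsto_pow_zero_of_spectrum_norm_lt_one {A : Type*} [NormedRing A] [NormedAlgebra ℂ A]
    [CompleteSpace A] [Nontrivial A] {a : A} (h : ∀ z ∈ spectrum ℂ a, ‖z‖ < 1) :
    Filter.Tendsto (fun n : ℕ => a ^ n) Filter.atTop (nhds 0) := by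
  have hlt : spectralRadius ℂ a < (1 : NNReal) :=
    spectrum.spectralRadius_lt_of_forall_lt a fun z hz => by exact_mod_cast h z hz
  obtain ⟨r, hr₁, hr₂⟩ := ENNReal.lt_iff_exists_nnreal_btwn.1 hlt
  have hev := (spectrum.pow_nnnorm_pow_one_div_tendsto_nhds_spectralRadius a).eventually_lt_const hr₁
  refine squeeze_zero_norm' (a := fun n : ℕ => (r : ℝ) ^ n) ?_
    (tendsto_pow_atTop_nhds_zero_of_lt_one r.2 (by exact_mod_cast hr₂))
  filter_upwards [hev, Filter.eventually_gt_atTop 0] with n hn hn0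
  have hn' : (0 : ℝ) < n := by exact_mod_cast hn0
  have h₁ := ENNReal.rpow_lt_rpow hn hn'
  rw [← ENNReal.rpow_mul, one_div, inv_mul_cancel₀ hn'.ne', ENNReal.rpow_one,
    ENNReal.rpow_natCast] at h₁
  have h₂ : ‖a ^ n‖₊ < r ^ n := by exact_mod_cast h₁
  exact_mod_cast h₂.le

/-- A Lyapunov-type inertia principle: if `S` is self-adjoint with `η ‖u‖ ≤ ‖S u‖`, `‖K‖ ≤ κ ≤ η`,
and the spectrum of `S + K` lies in the open left half-plane, then `S` is nonpositive. -/
theorem re_inner_nonpos_of_spectrum_re_neg {H : Type*} [NormedAddCommGroup H]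
    [InnerProductSpace ℂ H] [CompleteSpace H] {S K : H →L[ℂ] H} {η κ : ℝ} (hη : 0 < η)
    (hS : IsSelfAdjoint S) (hSη : ∀ u, η * ‖u‖ ≤ ‖S u‖) (hKκ : ∀ u, ‖K u‖ ≤ κ * ‖u‖) (hκ : κ ≤ η)
    (hspec : ∀ z ∈ spectrum ℂ (S + K), z.re < 0) (v : H) : (inner ℂ (S v) v).re ≤ 0 := by
  rcases subsingleton_or_nontrivial H with hH | hH
  · simp [Subsingleton.elim v 0]
  have hSu : IsUnit S := isUnit_of_bounded_below hη hSη (by rwa [hS.adjoint_eq])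
  set G : H →L[ℂ] H := Ring.inverse S with hG
  have hGS : ∀ u, G (S u) = u := fun u => by
    rw [← mul_apply_eq_comp, hG, Ring.inverse_mul_cancel _ hSu, one_apply_eq_self]
  have hSG : ∀ u, S (G u) = u := fun u => by
    rw [← mul_apply_eq_comp, hG, Ring.mul_inverse_cancel _ hSu, one_apply_eq_self]
  have hGsymm : ∀ u w, inner ℂ (G u) w = inner ℂ u (G w) := fun u w => by
    have := hS.isSymmetric (G u) (G w)
    simp only [ContinuousLinearMap.coe_coe, hSG] at this
    exact this.symm
  set B := S + K with hB
  have hGB : ∀ u, 0 ≤ (inner ℂ (G (B u)) u).re := fun u => by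
    have h₁ : (inner ℂ (G (B u)) u).re = ‖u‖ ^ 2 + (inner ℂ (G (K u)) u).re := by
      rw [hB, add_apply, map_add, hGS, inner_add_left, Complex.add_re]
      congr 1
      exact inner_self_eq_norm_sq (𝕜 := ℂ) u
    have h₂ : η * ‖G (K u)‖ ≤ κ * ‖u‖ := by
      have := hSη (G (K u))
      rw [hSG] at this
      exact this.trans (hKκ u)
    have h₃ : ‖G (K u)‖ ≤ ‖u‖ := by
      have : η * ‖G (K u)‖ ≤ η * ‖u‖ := h₂.trans (by gcongr)
      exact le_of_mul_le_mul_left this hη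
    have h₄ := (abs_le.1 (Complex.abs_re_le_norm (inner ℂ (G (K u)) u))).1
    have h₅ := norm_inner_le_norm (𝕜 := ℂ) (G (K u)) u
    rw [h₁]
    nlinarith [norm_nonneg u]
  have hmem : ∀ z : ℂ, 0 ≤ z.re → IsUnit (algebraMap ℂ (H →L[ℂ] H) z - B) := fun z hz => by
    by_contra hcon
    exact absurd (hspec z hcon) (not_lt.2 hz)
  have h1u : IsUnit (B - 1) := by
    have := (hmem 1 (by simp)).neg
    simpa using this
  set R := Ring.inverse (B - 1) with hR
  have hR' : (B - 1) * R = 1 := Ring.mul_inverse_cancel _ h1u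
  set C := (B + 1) * R with hC
  have hRu : IsUnit R := h1u.ringInverse
  have hsmul : ∀ {z : ℂ} {T : H →L[ℂ] H}, z ≠ 0 → IsUnit T → IsUnit (z • T) := fun hz hT => by
    rw [Algebra.smul_def]
    exact ((IsUnit.mk0 _ hz).map (algebraMap ℂ (H →L[ℂ] H))).mul hT
  have hCspec : ∀ w ∈ spectrum ℂ C, ‖w‖ < 1 := by
    intro w hw
    by_contra hcon
    push Not at hcon
    apply hw
    rw [spectrum.mem_resolventSet_iff]
    by_cases hw1 : w = 1
    · have : algebraMap ℂ (H →L[ℂ] H) w - C = (-2 : ℂ) • R := by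
        rw [hw1, map_one, ← hR', hC, ← sub_mul]
        have : B - 1 - (B + 1) = (-2 : ℂ) • (1 : H →L[ℂ] H) := by
          ext u; simp; module
        rw [this, smul_mul_assoc, one_mul]
      rw [this]
      exact hsmul (by norm_num) hRu
    · have hw1' : w - 1 ≠ 0 := sub_ne_zero.2 hw1
      have : algebraMap ℂ (H →L[ℂ] H) w - C =
          (-(w - 1)) • ((algebraMap ℂ (H →L[ℂ] H) ((w + 1) / (w - 1)) - B) * R) := by
        have h₁ : algebraMap ℂ (H →L[ℂ] H) w = (w • (B - 1)) * R := by
          rw [smul_mul_assoc, hR', Algebra.algebraMap_eq_smul_one]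
        rw [h₁, hC, ← sub_mul, ← smul_mul_assoc]
        congr 1
        rw [Algebra.algebraMap_eq_smul_one, smul_sub (-(w - 1)), smul_smul]
        have : -(w - 1) * ((w + 1) / (w - 1)) = -(w + 1) := by field_simp
        rw [this]
        module
      rw [this]
      refine hsmul (neg_ne_zero.2 hw1') ((hmem _ ?_).mul hRu)
      rw [Complex.div_re, ← add_div]
      refine div_nonneg ?_ (Complex.normSq_nonneg _)
      have : 1 ≤ w.re ^ 2 + w.im ^ 2 := by
        have := Complex.sq_norm w
        rw [Complex.normSq_apply] at this
        nlinarith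
      simp
      nlinarith
  have hpow := tendsto_pow_zero_of_spectrum_norm_lt_one hCspec
  have hstep : ∀ u, (inner ℂ (G u) u).re ≤ (inner ℂ (G (C u)) (C u)).re := by
    intro u
    have hu : u = B (R u) - R u := by
      conv_lhs => rw [← one_apply_eq_self (F := H →L[ℂ] H) u, ← hR']
      simp
    have hCu : C u = B (R u) + R u := by simp [hC]
    rw [hCu]
    conv_lhs => rw [hu]
    simp only [map_add, map_sub, inner_add_left, inner_add_right, inner_sub_left, inner_sub_right,
      Complex.add_re, Complex.sub_re]
    have h₁ := hGB (R u)
    have h₂ : (inner ℂ (G (R u)) (B (R u))).re = (inner ℂ (G (B (R u))) (R u)).re := by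
      rw [hGsymm, ← inner_conj_symm, Complex.conj_re]
    linarith
  have hiter : ∀ u (n : ℕ), (inner ℂ (G u) u).re ≤ (inner ℂ (G ((C ^ n) u)) ((C ^ n) u)).re := by
    intro u n
    induction n with
    | zero => simp
    | succ n ih =>
      rw [pow_succ', mul_apply_eq_comp]
      exact ih.trans (hstep _)
  have hlim : ∀ u, Filter.Tendsto (fun n : ℕ => (inner ℂ (G ((C ^ n) u)) ((C ^ n) u)).re)
      Filter.atTop (nhds 0) := by
    intro u
    have h₁ : Continuous fun T : H →L[ℂ] H => (inner ℂ (G (T u)) (T u)).re := by fun_prop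
    simpa [Function.comp_def] using (h₁.tendsto 0).comp hpow
  have := ge_of_tendsto' (hlim (S v)) (hiter (S v))
  rw [hGS, ← inner_conj_symm, Complex.conj_re] at this
  exact this

/-- For self-adjoint `S`, moving the spectral parameter off the real axis does not decrease
`‖(z - S) u‖`. -/
theorem norm_sub_smul_re_le {H : Type*} [NormedAddCommGroup H] [InnerProductSpace ℂ H]
    [CompleteSpace H] {S : H →L[ℂ] H} (hS : IsSelfAdjoint S) (z : ℂ) (u : H) :
    ‖S u - (z.re : ℂ) • u‖ ≤ ‖z • u - S u‖ := by
  refine le_of_sq_le_sq ?_ (norm_nonneg _)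
  have h₁ : z • u - S u = ((z.im : ℂ) * Complex.I) • u - (S u - (z.re : ℂ) • u) := by
    conv_lhs => rw [← Complex.re_add_im z]
    module
  have h₂ : (inner ℂ u (S u)).im = 0 := by
    have h₃ : inner ℂ (S u) u = inner ℂ u (S u) := hS.isSymmetric u u
    rw [← inner_conj_symm] at h₃
    exact Complex.conj_eq_iff_im.1 h₃
  have h₄ : (inner ℂ u u).im = 0 := inner_self_im (𝕜 := ℂ) u
  rw [h₁, norm_sub_sq (𝕜 := ℂ) (((z.im : ℂ) * Complex.I) • u)]
  have h₅ : RCLike.re (inner ℂ (((z.im : ℂ) * Complex.I) • u) (S u - (z.re : ℂ) • u)) = 0 := by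
    rw [inner_smul_left, inner_sub_right, inner_smul_right]
    simp [h₂, h₄, -inner_self_eq_norm_sq_to_K]
  rw [h₅]
  nlinarith [sq_nonneg ‖((z.im : ℂ) * Complex.I) • u‖]

/-- If the self-adjoint `S` has a spectral gap of radius `η > κ + ε` around `x` with spectrum on
both sides and `‖K‖ ≤ κ`, then the `ε`-pseudospectrum of `S + K` is not path-connected. -/
theorem not_isPathConnected_pseudospectrum {H : Type*} [NormedAddCommGroup H]
    [InnerProductSpace ℂ H] [CompleteSpace H] {S K : H →L[ℂ] H} {η κ ε x : ℝ} (hε : 0 < ε)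
    (hκ : 0 ≤ κ) (hη : ε + κ < η) (hS : IsSelfAdjoint S)
    (hgap : ∀ u, η * ‖u‖ ≤ ‖S u - (x : ℂ) • u‖)
    (hK : ∀ u, ‖K u‖ ≤ κ * ‖u‖) (hK' : ∀ u, ‖K.adjoint u‖ ≤ κ * ‖u‖)
    {e f : H} (he : 0 < (inner ℂ (S e - (x : ℂ) • e) e).re)
    (hf : (inner ℂ (S f - (x : ℂ) • f) f).re < 0) :
    ¬ IsPathConnected (pseudospectrum ε (S + K)) := by
  intro hconn
  have hη0 : 0 < η := by linarith
  have hbelow : ∀ {L : H →L[ℂ] H}, (∀ u, ‖L u‖ ≤ κ * ‖u‖) → ∀ z : ℂ, z.re = x → ∀ u,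
      (η - κ) * ‖u‖ ≤ ‖(algebraMap ℂ (H →L[ℂ] H) z - (S + L)) u‖ := by
    intro L hL z hz u
    have h₁ : (algebraMap ℂ (H →L[ℂ] H) z - (S + L)) u = (z • u - S u) - L u := by
      simp [Algebra.algebraMap_eq_smul_one]
      abel
    have h₂ := norm_sub_smul_re_le hS z u
    rw [hz] at h₂
    rw [h₁]
    have := norm_sub_norm_le (z • u - S u) (L u)
    linarith [hgap u, hL u]
  have hline : ∀ z ∈ pseudospectrum ε (S + K), z.re ≠ x := by
    intro z hz hzx
    have hadj : (algebraMap ℂ (H →L[ℂ] H) z - (S + K)).adjoint =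
        algebraMap ℂ (H →L[ℂ] H) (starRingEnd ℂ z) - (S + K.adjoint) := by
      rw [map_sub, map_add, hS.adjoint_eq, Algebra.algebraMap_eq_smul_one,
        Algebra.algebraMap_eq_smul_one]
      congr 1
      rw [← ContinuousLinearMap.star_eq_adjoint, star_smul, star_one]
      rfl
    have hr : 0 < η - κ := by linarith
    have hu : IsUnit (algebraMap ℂ (H →L[ℂ] H) z - (S + K)) :=
      isUnit_of_bounded_below hr (hbelow hK z hzx)
        (by rw [hadj]; exact hbelow hK' _ (by simpa using hzx))
    rcases hz with hz | hz
    · exact hz hu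
    · have h₁ := hz.trans (norm_ringInverse_le hr hu (hbelow hK z hzx))
      rw [inv_le_inv₀ hε hr] at h₁
      linarith
  have hS₀ : IsSelfAdjoint (S - (x : ℂ) • (1 : H →L[ℂ] H)) := by
    refine hS.sub (IsSelfAdjoint.smul ?_ (IsSelfAdjoint.one _))
    exact Complex.conj_ofReal x
  have hspec : ∀ w ∈ spectrum ℂ (S - (x : ℂ) • (1 : H →L[ℂ] H) + K),
      w + x ∈ pseudospectrum ε (S + K) := by
    intro w hw
    left
    intro hw'
    apply hw
    rw [spectrum.mem_resolventSet_iff] at hw' ⊢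
    convert hw' using 1
    rw [map_add, Algebra.algebraMap_eq_smul_one, Algebra.algebraMap_eq_smul_one]
    module
  have hpre := hconn.isConnected.isPreconnected
  have hopen₁ : IsOpen {z : ℂ | z.re < x} := isOpen_lt Complex.continuous_re continuous_const
  have hopen₂ : IsOpen {z : ℂ | x < z.re} := isOpen_lt continuous_const Complex.continuous_re
  have hdisj : Disjoint {z : ℂ | z.re < x} {z : ℂ | x < z.re} :=
    Set.disjoint_left.2 fun z h₁ h₂ => lt_asymm (show z.re < x from h₁) h₂
  rcases hpre.subset_or_subset hopen₁ hopen₂ hdisj (fun z hz => lt_or_gt_of_ne (hline z hz))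
    with h | h
  · have := re_inner_nonpos_of_spectrum_re_neg (K := K) (κ := κ) hη0 hS₀
      (by simpa using hgap) hK (by linarith)
      (fun w hw => by simpa using h (hspec w hw)) e
    simp only [sub_apply, smul_apply, one_apply_eq_self] at this
    linarith
  · have := re_inner_nonpos_of_spectrum_re_neg (S := -(S - (x : ℂ) • (1 : H →L[ℂ] H)))
      (K := -K) (κ := κ) hη0 hS₀.neg
      (by simpa [norm_sub_rev] using hgap) (by simpa using hK) (by linarith)
      (fun w hw => by
        rw [← neg_add, ← spectrum.neg_eq, Set.mem_neg] at hw
        have := h (hspec _ hw)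
        simpa using this) f
    simp only [neg_apply, sub_apply, smul_apply, one_apply_eq_self, inner_neg_left,
      Complex.neg_re] at this
    linarith

open Matrix in
/-- A real symmetric matrix has an orthonormal eigenbasis with decreasingly ordered eigenvalues. -/
theorem exists_antitone_eigenbasis {q : ℕ} {T : Matrix (Fin q) (Fin q) ℝ} (hT : T.IsHermitian) :
    ∃ (μ : Fin q → ℝ) (f : Fin q → Fin q → ℝ), Antitone μ ∧
      (∀ i j, f i ⬝ᵥ f j = if i = j then 1 else 0) ∧ (∀ i, T *ᵥ f i = μ i • f i) ∧
      ∑ i, μ i = T.trace := by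
  have hs := Matrix.isSymmetric_toEuclideanLin_iff.mpr hT
  have hn : Module.finrank ℝ (EuclideanSpace ℝ (Fin q)) = q := finrank_euclideanSpace_fin
  refine ⟨hs.eigenvalues hn, fun i => hs.eigenvectorBasis hn i, hs.eigenvalues_antitone hn,
    fun i j => ?_, fun i => ?_, ?_⟩
  · have := (orthonormal_iff_ite.1 (hs.eigenvectorBasis hn).orthonormal) j i
    rw [EuclideanSpace.inner_eq_star_dotProduct] at this
    simpa [eq_comm] using this
  · have := congrArg WithLp.ofLp (hs.apply_eigenvectorBasis hn i)
    simpa only [Matrix.ofLp_toLpLin, Matrix.toLin'_apply, WithLp.ofLp_smul,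
      RCLike.ofReal_real_eq_id, id] using this
  · have := hs.trace_eq_sum_eigenvalues hn
    simp only [RCLike.ofReal_real_eq_id, id] at this
    rw [← this]
    rw [Matrix.toEuclideanLin_eq_toLin_orthonormal, Matrix.trace_toLin_eq]

/-- The discrete Schrödinger-type operator with diagonal `a` and constant off-diagonal `h`. -/
def jacobiApply (a : ℤ → ℝ) (h : ℝ) (V : ℤ → ℝ) (s : ℤ) : ℝ :=
  h * V (s - 1) + a s * V s + h * V (s + 1)

/-- The `q × q` Dirichlet truncation of the Jacobi operator to the sites `m + 1, …, m + q`. -/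
def dirichletMatrix (q : ℕ) (a : ℤ → ℝ) (h : ℝ) (m : ℤ) : Matrix (Fin q) (Fin q) ℝ :=
  Matrix.of fun i j => (if (j : ℤ) = i then a (m + 1 + i) else 0) +
    (if (j : ℤ) = i - 1 then h else 0) + (if (j : ℤ) = i + 1 then h else 0)

theorem dirichletMatrix_isHermitian (q : ℕ) (a : ℤ → ℝ) (h : ℝ) (m : ℤ) :
    (dirichletMatrix q a h m).IsHermitian := by
  refine Matrix.IsHermitian.ext fun i j => ?_
  simp only [dirichletMatrix, Matrix.of_apply, star_trivial]
  rcases eq_or_ne i j with rfl | hij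
  · rfl
  · have h₀ : ((i : ℕ) : ℤ) ≠ j := fun hc => hij (Fin.ext (by exact_mod_cast hc))
    rw [if_neg h₀, if_neg h₀.symm]
    have h₁ : ((i : ℤ) = j - 1) ↔ ((j : ℤ) = i + 1) := by omega
    have h₂ : ((i : ℤ) = j + 1) ↔ ((j : ℤ) = i - 1) := by omega
    simp only [h₁, h₂]
    ring

theorem trace_dirichletMatrix (q : ℕ) (a : ℤ → ℝ) (h : ℝ) (m : ℤ) :
    (dirichletMatrix q a h m).trace = ∑ i : Fin q, a (m + 1 + i) := by
  simp only [Matrix.trace, Matrix.diag_apply, dirichletMatrix, Matrix.of_apply, if_true]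
  refine Finset.sum_congr rfl fun i _ => ?_
  rw [if_neg (by omega), if_neg (by omega), add_zero, add_zero]

theorem sum_fin_ite_intCast_eq {q : ℕ} (g : ℤ → ℝ) (c : ℤ) :
    ∑ j : Fin q, (if (j : ℤ) = c then g j else 0) = if 0 ≤ c ∧ c < q then g c else 0 := by
  split_ifs with hc
  · rw [Finset.sum_eq_single (⟨c.toNat, by omega⟩ : Fin q)]
    · simp [hc.1]
    · intro j _ hj
      rw [if_neg]
      intro hjc
      exact hj (Fin.ext (by simp; omega))
    · simp
  · refine Finset.sum_eq_zero fun j _ => if_neg ?_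
    omega

open Matrix in
theorem dirichletMatrix_mulVec {q : ℕ} (a : ℤ → ℝ) (h : ℝ) (m : ℤ) {V : ℤ → ℝ}
    (h₀ : V m = 0) (h₁ : V (m + q + 1) = 0) (i : Fin q) :
    (dirichletMatrix q a h m *ᵥ fun j : Fin q => V (m + 1 + j)) i =
      jacobiApply a h V (m + 1 + i) := by
  have key : ∀ (c : ℤ) (y : ℝ), -1 ≤ c → c ≤ q →
      ∑ j : Fin q, (if (j : ℤ) = c then y else 0) * V (m + 1 + j) = y * V (m + 1 + c) := by
    intro c y hc hc'
    simp only [ite_mul, zero_mul]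
    rw [sum_fin_ite_intCast_eq (fun s => y * V (m + 1 + s))]
    split_ifs with hcond
    · rfl
    · rcases (by omega : c = -1 ∨ c = q) with rfl | rfl
      · simp [h₀]
      · rw [add_right_comm, h₁, mul_zero]
  simp only [Matrix.mulVec, dotProduct, dirichletMatrix, Matrix.of_apply, add_mul,
    Finset.sum_add_distrib]
  rw [key i _ (by omega) (by omega), key (i - 1) _ (by omega) (by omega),
    key (i + 1) _ (by omega) (by omega), jacobiApply, add_sub_assoc, add_assoc (m + 1)]
  ring

theorem sum_range_succ_eq_sum_fin {q : ℕ} {g : ℤ → ℝ} {m : ℤ} (h₀ : g m = 0) :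
    ∑ t ∈ Finset.range (q + 1), g (m + t) = ∑ i : Fin q, g (m + 1 + i) := by
  rw [Finset.sum_range_succ', Finset.sum_range]
  simp [h₀, add_assoc, add_comm (1 : ℤ)]

open Matrix in
/-- Norm and quadratic form of a combination of Dirichlet eigenvectors over one block. -/
theorem sum_block_eigenvectors {q : ℕ} {ι : Type*} [Fintype ι] {a : ℤ → ℝ}
    {h : ℝ} {m : ℤ} {μ : ι → ℝ} {f : ι → Fin q → ℝ}
    (hf : ∀ i, f i ⬝ᵥ f i = 1) (hf' : ∀ i j, i ≠ j → f i ⬝ᵥ f j = 0)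
    (hμ : ∀ i, dirichletMatrix q a h m *ᵥ f i = μ i • f i) {V : ℤ → ℝ} (h₀ : V m = 0)
    (h₁ : V (m + q + 1) = 0) {c : ι → ℝ} (hV : ∀ j : Fin q, V (m + 1 + j) = ∑ i, c i * f i j) :
    ∑ t ∈ Finset.range (q + 1), V (m + t) * V (m + t) = ∑ i, c i * c i ∧
    ∑ t ∈ Finset.range (q + 1), V (m + t) * jacobiApply a h V (m + t) =
      ∑ i, μ i * (c i * c i) := by
  have hv : (fun j : Fin q => V (m + 1 + j)) = ∑ i, c i • f i := by
    ext j
    simp [hV]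
  have hdot : ∀ d : ι → ℝ, (∑ i, c i • f i) ⬝ᵥ (∑ i, d i • f i) = ∑ i, c i * d i := by
    intro d
    rw [sum_dotProduct]
    refine Finset.sum_congr rfl fun i _ => ?_
    rw [dotProduct_sum, Finset.sum_eq_single i]
    · simp [hf, mul_comm]
    · intro j _ hj
      simp [hf' i j hj.symm]
    · simp
  constructor
  · rw [sum_range_succ_eq_sum_fin (g := fun s => V s * V s) (by simp [h₀]), ← hdot c, ← hv]
    rfl
  · rw [sum_range_succ_eq_sum_fin (g := fun s => V s * jacobiApply a h V s) (by simp [h₀])]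
    have h₂ : (dirichletMatrix q a h m *ᵥ fun j : Fin q => V (m + 1 + j)) =
        ∑ i, (c i * μ i) • f i := by
      rw [hv, mulVec_sum]
      refine Finset.sum_congr rfl fun i _ => ?_
      rw [mulVec_smul, hμ, smul_smul]
    have h₃ := hdot (fun i => c i * μ i)
    rw [← h₂, ← hv] at h₃
    simp only [dotProduct, dirichletMatrix_mulVec a h m h₀ h₁] at h₃
    rw [h₃]
    exact Finset.sum_congr rfl fun i _ => by ring

theorem sum_range_add_one_of_periodic {M : ℕ} {g : ℤ → ℝ} (hg : ∀ s, g (s + M) = g s) :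
    ∑ s ∈ Finset.range M, g (s + 1) = ∑ s ∈ Finset.range M, g s := by
  have h₁ := Finset.sum_range_succ (fun s : ℕ => g s) M
  have h₂ := Finset.sum_range_succ' (fun s : ℕ => g s) M
  have h₃ : g M = g 0 := by simpa using hg 0
  simp only [Nat.cast_add, Nat.cast_one, Nat.cast_zero, h₃] at h₁ h₂
  linarith

theorem sum_range_add_of_periodic {M : ℕ} {g : ℤ → ℝ} (hg : ∀ s, g (s + M) = g s) (c : ℤ) :
    ∑ s ∈ Finset.range M, g (c + s) = ∑ s ∈ Finset.range M, g s := by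
  have hshift : ∀ c : ℤ, ∑ s ∈ Finset.range M, g (c + 1 + s) = ∑ s ∈ Finset.range M, g (c + s) := by
    intro c
    rw [← sum_range_add_one_of_periodic (g := fun s => g (c + s))
      (fun s => by rw [← hg (c + s), add_assoc])]
    exact Finset.sum_congr rfl fun s _ => by congr 1; ring
  induction c with
  | zero => simp
  | succ n ih => rw [hshift, ih]
  | pred n ih => rw [← ih, ← hshift, sub_add_cancel]

theorem sum_range_mul_eq (g : ℤ → ℝ) (N p : ℕ) (m : ℤ) :
    ∑ s ∈ Finset.range (N * p), g (m + s) =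
      ∑ r ∈ Finset.range N, ∑ t ∈ Finset.range p, g (m + r * p + t) := by
  induction N with
  | zero => simp
  | succ N ih =>
    rw [add_mul, one_mul, Finset.sum_range_add, ih, Finset.sum_range_succ]
    congr 1
    exact Finset.sum_congr rfl fun t _ => by push_cast; congr 1; ring

theorem eq_zero_of_periodic {M : ℕ} (hM : 0 < M) {g : ℤ → ℝ} (hg : ∀ s, g (s + M) = g s)
    (h : ∀ s < M, g (s : ℕ) = 0) (s : ℤ) : g s = 0 := by
  have hM' : (0 : ℤ) < M := by exact_mod_cast hM
  have h₁ := (show Function.Periodic g (M : ℤ) from hg).int_mul (s / M) (s % M)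
  rw [Int.cast_id, Int.emod_add_ediv_mul] at h₁
  rw [h₁]
  have h₂ := Int.emod_nonneg s hM'.ne'
  have h₃ := Int.emod_lt_of_pos s hM'
  have := h (s % M).toNat (by omega)
  rwa [Int.toNat_of_nonneg h₂] at this

/-- Extension of a vector on the sites `1, …, q` by zero to all of `ℤ`. -/
def extendZero {q : ℕ} (f : Fin q → ℝ) (t : ℤ) : ℝ :=
  ∑ j : Fin q, if (j : ℤ) = t - 1 then f j else 0

theorem extendZero_of_not_mem {q : ℕ} (f : Fin q → ℝ) {t : ℤ} (ht : t < 1 ∨ q < t) :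
    extendZero f t = 0 :=
  Finset.sum_eq_zero fun j _ => if_neg (by omega)

theorem extendZero_one_add {q : ℕ} (f : Fin q → ℝ) (j : Fin q) : extendZero f (1 + j) = f j := by
  rw [extendZero, Finset.sum_eq_single j]
  · simp
  · intro i _ hi
    rw [if_neg]
    intro hc
    exact hi (Fin.ext (by omega))
  · simp

/-- The `N p`-periodic sequence whose block on the sites `m + r p, …, m + r p + p - 1` is the
combination of the vectors `f i` (shifted by one site) with coefficients `α r i`. -/
def placeBlocks {q : ℕ} {ι : Type*} [Fintype ι] (N p : ℕ) (m : ℤ) (f : ι → Fin q → ℝ) :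
    (ZMod N → ι → ℝ) →ₗ[ℝ] (ℤ → ℝ) where
  toFun α s := ∑ i, α (((s - m) / p : ℤ) : ZMod N) i * extendZero (f i) ((s - m) % p)
  map_add' α β := by
    ext s
    simp [add_mul, Finset.sum_add_distrib]
  map_smul' r α := by
    ext s
    simp [mul_assoc, Finset.mul_sum]

section placeBlocks

variable {q : ℕ} {ι : Type*} [Fintype ι] (N : ℕ) (m : ℤ) (f : ι → Fin q → ℝ) (α : ZMod N → ι → ℝ)

theorem placeBlocks_periodic (s : ℤ) :
    placeBlocks N (q + 1) m f α (s + (N * (q + 1) : ℕ)) = placeBlocks N (q + 1) m f α s := by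
  have hq : ((q + 1 : ℕ) : ℤ) ≠ 0 := by omega
  have h₁ : s + (N * (q + 1) : ℕ) - m = (s - m) + N * ((q + 1 : ℕ) : ℤ) := by push_cast; ring
  simp only [placeBlocks, LinearMap.coe_mk, AddHom.coe_mk]
  rw [h₁, Int.add_mul_ediv_right _ _ hq, Int.add_mul_emod_self_right]
  simp

theorem placeBlocks_apply (r : ℤ) {t : ℤ} (ht : 0 ≤ t) (ht' : t < q + 1) :
    placeBlocks N (q + 1) m f α (m + r * (q + 1 : ℕ) + t) = ∑ i, α r i * extendZero (f i) t := by
  have hq : ((q + 1 : ℕ) : ℤ) ≠ 0 := by omega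
  have h₁ : m + r * (q + 1 : ℕ) + t - m = t + r * ((q + 1 : ℕ) : ℤ) := by push_cast; ring
  simp only [placeBlocks, LinearMap.coe_mk, AddHom.coe_mk]
  rw [h₁, Int.add_mul_ediv_right _ _ hq, Int.add_mul_emod_self_right,
    Int.ediv_eq_zero_of_lt ht (by push_cast; omega), Int.emod_eq_of_lt ht (by push_cast; omega),
    zero_add]

theorem placeBlocks_apply_zero (r : ℤ) :
    placeBlocks N (q + 1) m f α (m + r * (q + 1 : ℕ)) = 0 := by
  have := placeBlocks_apply N m f α r le_rfl (by omega)
  rw [add_zero] at this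
  rw [this]
  exact Finset.sum_eq_zero fun i _ => by rw [extendZero_of_not_mem _ (by omega), mul_zero]

variable {N m f} {a : ℤ → ℝ} {h : ℝ} {μ : ι → ℝ}

open Matrix in
theorem sum_placeBlocks_block (ha : ∀ n : ℤ, a (n + (q + 1 : ℕ)) = a n)
    (hf : ∀ i, f i ⬝ᵥ f i = 1) (hf' : ∀ i j, i ≠ j → f i ⬝ᵥ f j = 0)
    (hμ : ∀ i, dirichletMatrix q a h m *ᵥ f i = μ i • f i) (r : ℤ) :
    ∑ t ∈ Finset.range (q + 1), placeBlocks N (q + 1) m f α (m + r * (q + 1 : ℕ) + t) *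
        placeBlocks N (q + 1) m f α (m + r * (q + 1 : ℕ) + t) = ∑ i, α r i * α r i ∧
    ∑ t ∈ Finset.range (q + 1), placeBlocks N (q + 1) m f α (m + r * (q + 1 : ℕ) + t) *
        jacobiApply a h (placeBlocks N (q + 1) m f α) (m + r * (q + 1 : ℕ) + t) =
      ∑ i, μ i * (α r i * α r i) := by
  have hper : dirichletMatrix q a h (m + r * (q + 1 : ℕ)) = dirichletMatrix q a h m := by
    have : ∀ n : ℤ, a (n + r * (q + 1 : ℕ)) = a n :=
      (show Function.Periodic a ((q + 1 : ℕ) : ℤ) from ha).int_mul r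
    ext i j
    simp only [dirichletMatrix, Matrix.of_apply]
    rw [← this (m + 1 + i)]
    ring_nf
  refine sum_block_eigenvectors hf hf' (by rwa [hper]) (placeBlocks_apply_zero N m f α r) ?_ ?_
  · have := placeBlocks_apply_zero N m f α (r + 1)
    rwa [add_mul, one_mul, ← add_assoc, Nat.cast_add_one, ← add_assoc] at this
  · intro j
    rw [add_assoc _ 1, placeBlocks_apply N m f α r (by omega) (by omega)]
    exact Finset.sum_congr rfl fun i _ => by rw [extendZero_one_add]

end placeBlocks

section placeBlocksForm

variable {q : ℕ} {ι : Type*} [Fintype ι] {N : ℕ} {m : ℤ} {f : ι → Fin q → ℝ} {a : ℤ → ℝ} {h : ℝ}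
  {μ : ι → ℝ}

theorem jacobiApply_periodic {M : ℕ} (ha : ∀ n : ℤ, a (n + M) = a n) {V : ℤ → ℝ}
    (hV : ∀ s : ℤ, V (s + M) = V s) (s : ℤ) :
    jacobiApply a h V (s + M) = jacobiApply a h V s := by
  rw [jacobiApply, jacobiApply, ha, hV, add_sub_right_comm s, hV, add_right_comm s, hV]

open Matrix in
theorem sum_placeBlocks (ha : ∀ n : ℤ, a (n + (q + 1 : ℕ)) = a n)
    (hf : ∀ i, f i ⬝ᵥ f i = 1) (hf' : ∀ i j, i ≠ j → f i ⬝ᵥ f j = 0)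
    (hμ : ∀ i, dirichletMatrix q a h m *ᵥ f i = μ i • f i) (α : ZMod N → ι → ℝ) :
    ∑ s ∈ Finset.range (N * (q + 1)), placeBlocks N (q + 1) m f α s *
        placeBlocks N (q + 1) m f α s = ∑ r ∈ Finset.range N, ∑ i, α r i * α r i ∧
    ∑ s ∈ Finset.range (N * (q + 1)), placeBlocks N (q + 1) m f α s *
        jacobiApply a h (placeBlocks N (q + 1) m f α) s =
      ∑ r ∈ Finset.range N, ∑ i, μ i * (α r i * α r i) := by
  have hper := placeBlocks_periodic N m f α
  have ha' : ∀ n : ℤ, a (n + (N * (q + 1) : ℕ)) = a n := by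
    intro n
    have := (show Function.Periodic a ((q + 1 : ℕ) : ℤ) from ha).int_mul N n
    rw [← this]
    push_cast
    rfl
  constructor
  · rw [← sum_range_add_of_periodic (M := N * (q + 1)) (g := fun s => placeBlocks N (q + 1) m f α s *
      placeBlocks N (q + 1) m f α s) (fun s => by simp only [hper]) m, sum_range_mul_eq
      (fun s => placeBlocks N (q + 1) m f α s * placeBlocks N (q + 1) m f α s)]
    refine Finset.sum_congr rfl fun r _ => ?_
    rw [(sum_placeBlocks_block α ha hf hf' hμ r).1, Int.cast_natCast]
  · rw [← sum_range_add_of_periodic (M := N * (q + 1)) (g := fun s => placeBlocks N (q + 1) m f α s *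
      jacobiApply a h (placeBlocks N (q + 1) m f α) s)
      (fun s => by simp only [hper, jacobiApply_periodic ha' hper]) m, sum_range_mul_eq
      (fun s => placeBlocks N (q + 1) m f α s * jacobiApply a h (placeBlocks N (q + 1) m f α) s)]
    refine Finset.sum_congr rfl fun r _ => ?_
    rw [(sum_placeBlocks_block α ha hf hf' hμ r).2, Int.cast_natCast]

theorem placeBlocks_coeff_eq_zero [NeZero N] {α : ZMod N → ι → ℝ}
    (h₀ : ∑ r ∈ Finset.range N, ∑ i, α r i * α r i = 0) : α = 0 := by
  ext r i
  have h₁ := (Finset.sum_eq_zero_iff_of_nonneg fun r _ =>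
    Finset.sum_nonneg fun i _ => mul_self_nonneg _).1 h₀ r.val (by simp [ZMod.val_lt])
  have h₂ := (Finset.sum_eq_zero_iff_of_nonneg fun i _ => mul_self_nonneg _).1 h₁ i (by simp)
  rw [ZMod.natCast_zmod_val] at h₂
  simpa using h₂

end placeBlocksForm

theorem sum_jacobiApply_mul_comm {M : ℕ} (a : ℤ → ℝ) (h : ℝ) {V W : ℤ → ℝ}
    (hV : ∀ s : ℤ, V (s + M) = V s) (hW : ∀ s : ℤ, W (s + M) = W s) :
    ∑ s ∈ Finset.range M, V s * jacobiApply a h W s =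
      ∑ s ∈ Finset.range M, W s * jacobiApply a h V s := by
  have hshift : ∀ {V W : ℤ → ℝ}, (∀ s : ℤ, V (s + M) = V s) → (∀ s : ℤ, W (s + M) = W s) →
      ∑ s ∈ Finset.range M, V s * W (s - 1) = ∑ s ∈ Finset.range M, W s * V (s + 1) := by
    intro V W hV hW
    have := sum_range_add_one_of_periodic (M := M) (g := fun s => V s * W (s - 1))
      (fun s => by rw [hV, add_sub_right_comm, hW])
    rw [← this]
    exact Finset.sum_congr rfl fun s _ => by rw [add_sub_cancel_right, mul_comm]
  have h₁ := hshift hV hW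
  have h₂ := hshift hW hV
  simp only [jacobiApply, mul_add, Finset.sum_add_distrib, mul_left_comm _ h, ← Finset.mul_sum,
    h₁, h₂, mul_left_comm _ (a _)]
  simp only [mul_comm (V _) (W _)]
  ring

open Matrix in
/-- If Dirichlet eigenvectors of `m` with eigenvalue at least `x + η` and Dirichlet eigenvectors of
`n` with eigenvalue at most `x - η` together number one period, then the periodic Jacobi operator
minus `x` is bounded below by `η`. -/
theorem sum_sq_le_of_dirichlet {q N : ℕ} [NeZero N] {ι κ : Type*} [Fintype ι] [Fintype κ]
    (hcard : Fintype.card ι + Fintype.card κ = q + 1) {a : ℤ → ℝ} {h x η : ℝ} (hη : 0 < η)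
    (ha : ∀ n : ℤ, a (n + (q + 1 : ℕ)) = a n) {m n : ℤ}
    {f : ι → Fin q → ℝ} {μ : ι → ℝ} (hf : ∀ i, f i ⬝ᵥ f i = 1)
    (hf' : ∀ i j, i ≠ j → f i ⬝ᵥ f j = 0)
    (hfμ : ∀ i, dirichletMatrix q a h m *ᵥ f i = μ i • f i) (hμ : ∀ i, x + η ≤ μ i)
    {g : κ → Fin q → ℝ} {ν : κ → ℝ} (hg : ∀ i, g i ⬝ᵥ g i = 1)
    (hg' : ∀ i j, i ≠ j → g i ⬝ᵥ g j = 0)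
    (hgν : ∀ i, dirichletMatrix q a h n *ᵥ g i = ν i • g i) (hν : ∀ i, ν i ≤ x - η)
    {w : ℤ → ℝ} (hw : ∀ s : ℤ, w (s + (N * (q + 1) : ℕ)) = w s) :
    η ^ 2 * ∑ s ∈ Finset.range (N * (q + 1)), w s ^ 2 ≤
      ∑ s ∈ Finset.range (N * (q + 1)), (jacobiApply a h w s - x * w s) ^ 2 := by
  set M := N * (q + 1) with hM
  have hMpos : 0 < M := Nat.mul_pos (NeZero.pos N) (Nat.succ_pos q)
  set P := placeBlocks N (q + 1) m f
  set Q := placeBlocks N (q + 1) n g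
  have hPper : ∀ α s, P α (s + M) = P α s := placeBlocks_periodic N m f
  have hQper : ∀ β s, Q β (s + M) = Q β s := placeBlocks_periodic N n g
  have hP : ∀ α, (x + η) * ∑ s ∈ Finset.range M, P α s * P α s ≤
      ∑ s ∈ Finset.range M, P α s * jacobiApply a h (P α) s := by
    intro α
    obtain ⟨h₁, h₂⟩ := sum_placeBlocks (N := N) ha hf hf' hfμ α
    rw [h₁, h₂]
    simp only [Finset.mul_sum]
    gcongr with r _ i _
    · exact mul_self_nonneg _
    · exact hμ i
  have hQ : ∀ β, ∑ s ∈ Finset.range M, Q β s * jacobiApply a h (Q β) s ≤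
      (x - η) * ∑ s ∈ Finset.range M, Q β s * Q β s := by
    intro β
    obtain ⟨h₁, h₂⟩ := sum_placeBlocks (N := N) ha hg hg' hgν β
    rw [h₁, h₂]
    simp only [Finset.mul_sum]
    gcongr with r _ i _
    · exact mul_self_nonneg _
    · exact hν i
  let R : (ℤ → ℝ) →ₗ[ℝ] (Fin M → ℝ) := LinearMap.funLeft ℝ ℝ fun i : Fin M => ((i : ℕ) : ℤ)
  let Ψ : ((ZMod N → ι → ℝ) × (ZMod N → κ → ℝ)) →ₗ[ℝ] (Fin M → ℝ) := R ∘ₗ P.coprod Q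
  have hR : ∀ {V W : ℤ → ℝ}, (∀ s : ℤ, V (s + M) = V s) → (∀ s : ℤ, W (s + M) = W s) →
      R V = R W → V = W := by
    intro V W hV hW hVW
    funext s
    refine sub_eq_zero.1 (eq_zero_of_periodic hMpos (g := fun s => V s - W s)
      (fun s => by rw [hV, hW]) (fun s hs => ?_) s)
    exact sub_eq_zero.2 (congrFun hVW ⟨s, hs⟩)
  have hinj : Function.Injective Ψ := by
    rw [← LinearMap.ker_eq_bot, LinearMap.ker_eq_bot']
    rintro ⟨α, β⟩ h₀
    have h₁ : P α = -Q β := by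
      refine hR (hPper α) (fun s => by simp [hQper]) ?_
      rw [map_neg, ← sub_eq_zero, sub_neg_eq_add]
      simpa [Ψ] using h₀
    have h₂ := hP α
    have h₃ := hQ β
    have h₄ : ∑ s ∈ Finset.range M, P α s * jacobiApply a h (P α) s =
        ∑ s ∈ Finset.range M, Q β s * jacobiApply a h (Q β) s := by
      refine Finset.sum_congr rfl fun s _ => ?_
      simp only [h₁, jacobiApply, Pi.neg_apply]
      ring
    have h₅ : ∑ s ∈ Finset.range M, P α s * P α s = ∑ s ∈ Finset.range M, Q β s * Q β s :=
      Finset.sum_congr rfl fun s _ => by simp [h₁]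
    have h₆ : 0 ≤ ∑ s ∈ Finset.range M, Q β s * Q β s :=
      Finset.sum_nonneg fun s _ => mul_self_nonneg _
    have h₇ : ∑ s ∈ Finset.range M, Q β s * Q β s = 0 := by
      rw [h₄, h₅] at h₂
      nlinarith
    have h₈ := h₅.trans h₇
    rw [(sum_placeBlocks (N := N) ha hf hf' hfμ α).1] at h₈
    rw [(sum_placeBlocks (N := N) ha hg hg' hgν β).1] at h₇
    rw [placeBlocks_coeff_eq_zero h₈, placeBlocks_coeff_eq_zero h₇]
    rfl
  have hsurj : Function.Surjective Ψ := by
    refine (LinearMap.injective_iff_surjective_of_finrank_eq_finrank ?_).1 hinj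
    simp only [Module.finrank_prod, Module.finrank_pi_fintype, Module.finrank_self,
      Finset.sum_const, Finset.card_univ, ZMod.card, Fintype.card_fin, smul_eq_mul, mul_one]
    rw [← mul_add, hcard]
  obtain ⟨⟨α, β⟩, hαβ⟩ := hsurj (R w)
  have hwPQ : w = P α + Q β := by
    refine hR hw (fun s => by simp [hPper, hQper]) ?_
    rw [← hαβ]
    rfl
  have hcross := sum_jacobiApply_mul_comm a h (hPper α) (hQper β)
  have h₁ := hP α
  have h₂ := hQ β
  have h₃ : 0 ≤ ∑ s ∈ Finset.range M,
      ((jacobiApply a h w s - x * w s) - η * (P α s - Q β s)) ^ 2 :=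
    Finset.sum_nonneg fun s _ => sq_nonneg _
  have h₄ : ∑ s ∈ Finset.range M, ((jacobiApply a h w s - x * w s) - η * (P α s - Q β s)) ^ 2 =
      ∑ s ∈ Finset.range M, (jacobiApply a h w s - x * w s) ^ 2 -
        η ^ 2 * ∑ s ∈ Finset.range M, w s ^ 2 -
      2 * η * ((∑ s ∈ Finset.range M, P α s * jacobiApply a h (P α) s -
          (x + η) * ∑ s ∈ Finset.range M, P α s * P α s) +
        ((x - η) * ∑ s ∈ Finset.range M, Q β s * Q β s -
          ∑ s ∈ Finset.range M, Q β s * jacobiApply a h (Q β) s) +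
        (∑ s ∈ Finset.range M, P α s * jacobiApply a h (Q β) s -
          ∑ s ∈ Finset.range M, Q β s * jacobiApply a h (P α) s)) := by
    simp only [Finset.mul_sum, ← Finset.sum_sub_distrib, ← Finset.sum_add_distrib]
    refine Finset.sum_congr rfl fun s _ => ?_
    simp only [hwPQ, jacobiApply, Pi.add_apply]
    ring
  rw [hcross, sub_self, add_zero] at h₄
  nlinarith [mul_nonneg hη.le (sub_nonneg.2 h₁), mul_nonneg hη.le (sub_nonneg.2 h₂)]

open Matrix in
/-- `sum_sq_le_of_dirichlet` for finitely supported sequences, over any window of whole periods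
containing the support. -/
theorem sum_sq_le_of_support {q N L : ℕ} (hL : 2 * L < N * (q + 1)) {a : ℤ → ℝ} {h x η : ℝ}
    (hb : ∀ {w : ℤ → ℝ}, (∀ s : ℤ, w (s + (N * (q + 1) : ℕ)) = w s) →
      η ^ 2 * ∑ s ∈ Finset.range (N * (q + 1)), w s ^ 2 ≤
        ∑ s ∈ Finset.range (N * (q + 1)), (jacobiApply a h w s - x * w s) ^ 2)
    (ha : ∀ n : ℤ, a (n + (N * (q + 1) : ℕ)) = a n)
    {v : ℤ → ℝ} (hv : ∀ s : ℤ, (L : ℤ) ≤ |s| → v s = 0) :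
    η ^ 2 * ∑ s ∈ Finset.range (N * (q + 1)), v (-L + s) ^ 2 ≤
      ∑ s ∈ Finset.range (N * (q + 1)), (jacobiApply a h v (-L + s) - x * v (-L + s)) ^ 2 := by
  generalize N * (q + 1) = M at *
  have hv' : ∀ s : ℤ, s ≤ -L ∨ L ≤ s → v s = 0 := fun s hs => hv s (le_abs'.2 hs)
  let w : ℤ → ℝ := fun s => v ((s + L) % M - L)
  have hw : ∀ s : ℤ, w (s + M) = w s := fun s => by
    simp only [w]
    rw [add_right_comm s, Int.add_emod_right]
  have hwv : ∀ s : ℤ, -L - 1 ≤ s → s ≤ -L + M → w s = v s := by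
    intro s hs hs'
    have hmid : ∀ s : ℤ, -L ≤ s → s < -L + M → w s = v s := by
      intro s hs hs'
      simp only [w]
      rw [Int.emod_eq_of_lt (by omega) (by omega), add_sub_cancel_right]
    rcases (by omega : s = -L - 1 ∨ s = -L + M ∨ (-L ≤ s ∧ s < -L + M)) with hs₁ | hs₁ | ⟨h₁, h₂⟩
    · rw [← hw s, hmid _ (by omega) (by omega), hv' _ (by omega), hv' _ (by omega)]
    · rw [hs₁, hw, hmid _ (by omega) (by omega), hv' _ (by omega), hv' _ (by omega)]
    · exact hmid s h₁ h₂
  have key := hb hw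
  rw [← sum_range_add_of_periodic (g := fun s => w s ^ 2) (fun s => by simp only [hw]) (-L),
    ← sum_range_add_of_periodic (g := fun s => (jacobiApply a h w s - x * w s) ^ 2)
      (fun s => by simp only [hw, jacobiApply_periodic ha hw]) (-L)] at key
  convert key using 2
  · refine Finset.sum_congr rfl fun s hs => ?_
    have := Finset.mem_range.1 hs
    rw [hwv _ (by omega) (by omega)]
  · rename_i s hs
    have := Finset.mem_range.1 hs
    rw [jacobiApply, jacobiApply, hwv _ (by omega) (by omega), hwv _ (by omega) (by omega),
      hwv _ (by omega) (by omega)]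

/-- The Hilbert space `ℓ²(ℤ)`. -/
abbrev EllTwo : Type := lp (fun _ : ℤ => ℂ) 2

theorem EllTwo.hasSum_norm_sq (u : EllTwo) : HasSum (fun n => ‖u n‖ ^ 2) (‖u‖ ^ 2) := by
  simpa using lp.hasSum_norm (by simp) u

/-- The `ℓ²(ℤ)` operator `S` acts as the Jacobi matrix with diagonal `a` and off-diagonal `h`. -/
def IsJacobi (S : EllTwo →L[ℂ] EllTwo) (a : ℤ → ℝ) (h : ℝ) : Prop :=
  ∀ u n, S u n = (h : ℂ) * u (n - 1) + (a n : ℂ) * u n + (h : ℂ) * u (n + 1)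

theorem IsJacobi.norm_sq_sub_smul {S : EllTwo →L[ℂ] EllTwo} {a : ℤ → ℝ} {h : ℝ}
    (hS : IsJacobi S a h) (x : ℝ) (u : EllTwo) (n : ℤ) :
    ‖(S u - (x : ℂ) • u) n‖ ^ 2 =
      (jacobiApply a h (fun s => (u s).re) n - x * (u n).re) ^ 2 +
      (jacobiApply a h (fun s => (u s).im) n - x * (u n).im) ^ 2 := by
  rw [lp.coeFn_sub, Pi.sub_apply, lp.coeFn_smul, Pi.smul_apply, hS, Complex.sq_norm,
    Complex.normSq_apply]
  simp [jacobiApply]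
  ring

theorem IsJacobi.le_norm_sub_smul {S : EllTwo →L[ℂ] EllTwo} {a : ℤ → ℝ} {h : ℝ}
    (hS : IsJacobi S a h) {q : ℕ} (ha : ∀ n : ℤ, a (n + (q + 1 : ℕ)) = a n) {x η : ℝ}
    (hb : ∀ (N : ℕ) [NeZero N] {w : ℤ → ℝ}, (∀ s : ℤ, w (s + (N * (q + 1) : ℕ)) = w s) →
      η ^ 2 * ∑ s ∈ Finset.range (N * (q + 1)), w s ^ 2 ≤
        ∑ s ∈ Finset.range (N * (q + 1)), (jacobiApply a h w s - x * w s) ^ 2)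
    (u : EllTwo) : η * ‖u‖ ≤ ‖S u - (x : ℂ) • u‖ := by
  have hclosed : IsClosed {u : EllTwo | η * ‖u‖ ≤ ‖S u - (x : ℂ) • u‖} :=
    isClosed_le (by fun_prop) (by fun_prop)
  refine hclosed.mem_of_tendsto (lp.hasSum_single ENNReal.ofNat_ne_top u)
    (Filter.Eventually.of_forall fun F => ?_)
  set v : EllTwo := ∑ n ∈ F, lp.single 2 n (u n) with hv
  have hvF : ∀ n, n ∉ F → v n = 0 := by
    intro n hn
    rw [hv, lp.coeFn_sum, Finset.sum_apply]
    refine Finset.sum_eq_zero fun i hi => ?_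
    rw [lp.single_apply, Pi.single_eq_of_ne]
    rintro rfl
    exact hn hi
  obtain ⟨L, hL⟩ : ∃ L : ℕ, ∀ s : ℤ, (L : ℤ) ≤ |s| → v s = 0 := by
    refine ⟨∑ n ∈ F, n.natAbs + 1, fun s hs => hvF s fun hsF => ?_⟩
    have := Finset.single_le_sum (f := Int.natAbs) (fun _ _ => Nat.zero_le _) hsF
    rw [Int.abs_eq_natAbs] at hs
    omega
  let N := 2 * L + 1
  have hN : 2 * L < N * (q + 1) := by
    simp only [N]
    nlinarith
  have ha' : ∀ n : ℤ, a (n + (N * (q + 1) : ℕ)) = a n := by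
    intro n
    rw [← (show Function.Periodic a ((q + 1 : ℕ) : ℤ) from ha).int_mul N n]
    push_cast
    rfl
  have : NeZero N := ⟨by omega⟩
  have hre := sum_sq_le_of_support hN (hb N) ha' (v := fun s => (v s).re)
    fun s hs => by rw [hL s hs, Complex.zero_re]
  have him := sum_sq_le_of_support hN (hb N) ha' (v := fun s => (v s).im)
    fun s hs => by rw [hL s hs, Complex.zero_im]
  let W : ℕ ↪ ℤ := ⟨fun s => -L + s, fun s t hst => by simpa using hst⟩
  have h₁ : ‖v‖ ^ 2 = ∑ s ∈ Finset.range (N * (q + 1)), ‖v (-L + s)‖ ^ 2 := by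
    rw [← (EllTwo.hasSum_norm_sq v).tsum_eq,
      tsum_eq_sum (s := (Finset.range (N * (q + 1))).map W), Finset.sum_map]
    · rfl
    · intro n hn
      rw [hL n, norm_zero, zero_pow two_ne_zero]
      by_contra hc
      rw [not_le, abs_lt] at hc
      refine hn (Finset.mem_map.2 ⟨(n + L).toNat, Finset.mem_range.2 (by omega), ?_⟩)
      change -(L : ℤ) + ((n + L).toNat : ℤ) = n
      omega
  have h₂ : ∑ s ∈ Finset.range (N * (q + 1)), ‖(S v - (x : ℂ) • v) (-L + s)‖ ^ 2 ≤
      ‖S v - (x : ℂ) • v‖ ^ 2 := by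
    have := sum_le_hasSum ((Finset.range (N * (q + 1))).map W) (fun _ _ => sq_nonneg _)
      (EllTwo.hasSum_norm_sq (S v - (x : ℂ) • v))
    rwa [Finset.sum_map] at this
  refine le_of_pow_le_pow_left₀ two_ne_zero (norm_nonneg _) (le_trans ?_ h₂)
  rw [mul_pow, h₁]
  simp only [hS.norm_sq_sub_smul, Finset.sum_add_distrib]
  refine le_trans (le_of_eq ?_) (add_le_add hre him)
  rw [← mul_add, ← Finset.sum_add_distrib]
  congr 1
  refine Finset.sum_congr rfl fun s _ => ?_
  rw [Complex.sq_norm, Complex.normSq_apply]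
  ring

open Matrix in
/-- A normalised Dirichlet eigenvector, extended by zero, is a test vector whose quadratic form is
the eigenvalue. -/
theorem IsJacobi.exists_inner_eq {S : EllTwo →L[ℂ] EllTwo} {a : ℤ → ℝ} {h : ℝ}
    (hS : IsJacobi S a h) {q : ℕ} {m : ℤ} {f : Fin q → ℝ} {μ : ℝ} (hf : f ⬝ᵥ f = 1)
    (hμ : dirichletMatrix q a h m *ᵥ f = μ • f) (x : ℝ) :
    ∃ e : EllTwo, (inner ℂ (S e - (x : ℂ) • e) e).re = μ - x := by
  let e : EllTwo := ∑ j : Fin q, lp.single 2 (m + 1 + j : ℤ) (f j : ℂ)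
  have he : ∀ s : ℤ, e s = (extendZero f (s - m) : ℝ) := by
    intro s
    simp only [e, extendZero]
    rw [lp.coeFn_sum, Finset.sum_apply, Complex.ofReal_sum]
    refine Finset.sum_congr rfl fun j _ => ?_
    rw [lp.single_apply, Pi.single_apply]
    have : s = m + 1 + j ↔ (j : ℤ) = s - m - 1 := by omega
    simp only [this]
    split_ifs <;> simp
  have hfe : f = fun j : Fin q => extendZero f (m + 1 + j - m) := by
    funext j
    rw [add_assoc, add_sub_cancel_left, extendZero_one_add]
  have happ : ∀ j : Fin q, (S e - (x : ℂ) • e) (m + 1 + j) = ((μ - x) * f j : ℝ) := by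
    intro j
    have h₁ := dirichletMatrix_mulVec (q := q) a h m (V := fun s => extendZero f (s - m))
      (extendZero_of_not_mem _ (by omega)) (extendZero_of_not_mem _ (by omega)) j
    rw [← hfe, hμ, Pi.smul_apply, smul_eq_mul] at h₁
    have h₂ : f j = extendZero f (m + 1 + j - m) := congrFun hfe j
    rw [lp.coeFn_sub, Pi.sub_apply, lp.coeFn_smul, Pi.smul_apply, hS, smul_eq_mul, he, he, he,
      sub_mul, h₁, jacobiApply, h₂]
    push_cast
    ring
  refine ⟨e, ?_⟩
  have h₃ : inner ℂ (S e - (x : ℂ) • e) e = ∑ j : Fin q, (((μ - x) * (f j * f j) : ℝ) : ℂ) := by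
    nth_rewrite 3 [show e = ∑ j : Fin q, lp.single 2 (m + 1 + j : ℤ) (f j : ℂ) from rfl]
    rw [inner_sum]
    refine Finset.sum_congr rfl fun j _ => ?_
    rw [lp.inner_single_right, happ, RCLike.inner_apply, Complex.conj_ofReal]
    push_cast
    ring
  rw [h₃, ← Complex.ofReal_sum, Complex.ofReal_re, ← Finset.mul_sum]
  rw [dotProduct] at hf
  rw [hf, mul_one]

section Adjoint

variable {J : EllTwo →L[ℂ] EllTwo} {a : ℤ → ℝ} {b c : ℝ}

theorem adjoint_apply_of_tridiagonal
    (hJ : ∀ u : EllTwo, ∀ n : ℤ,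
      J u n = (c : ℂ) * u (n - 1) + (a n : ℂ) * u n + (b : ℂ) * u (n + 1))
    (u : EllTwo) (n : ℤ) :
    J.adjoint u n = (b : ℂ) * u (n - 1) + (a n : ℂ) * u n + (c : ℂ) * u (n + 1) := by
  have h₁ : J (lp.single 2 n (1 : ℂ)) = lp.single 2 (n - 1) (b : ℂ) + lp.single 2 n (a n : ℂ) +
      lp.single 2 (n + 1) (c : ℂ) := by
    refine lp.ext (funext fun s => ?_)
    rw [hJ]
    simp only [lp.coeFn_add, Pi.add_apply, lp.single_apply, Pi.single_apply]
    rcases eq_or_ne s n with rfl | hs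
    · simp [show s ≠ s - 1 by omega]
    · rcases eq_or_ne s (n - 1) with rfl | hs'
      · simp [show n - 1 - 1 ≠ n by omega, show n - 1 ≠ n + 1 by omega]
      · rcases eq_or_ne s (n + 1) with rfl | hs''
        · simp [show n + 1 + 1 ≠ n by omega, show n + 1 ≠ n - 1 by omega]
        · simp [hs, hs', hs'', show s - 1 ≠ n by omega, show s + 1 ≠ n by omega]
  have h₂ := ContinuousLinearMap.adjoint_inner_right J (lp.single 2 n (1 : ℂ)) u
  rw [h₁] at h₂
  simpa [inner_add_left, lp.inner_single_left, mul_comm] using h₂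

/-- The symmetric part of a tridiagonal operator with constant off-diagonals. -/
theorem isJacobi_realPart
    (hJ : ∀ u : EllTwo, ∀ n : ℤ,
      J u n = (c : ℂ) * u (n - 1) + (a n : ℂ) * u n + (b : ℂ) * u (n + 1)) :
    IsJacobi ((2⁻¹ : ℂ) • (J + J.adjoint)) a ((b + c) / 2) := by
  intro u n
  rw [smul_apply, add_apply, lp.coeFn_smul, Pi.smul_apply, lp.coeFn_add, Pi.add_apply, hJ,
    adjoint_apply_of_tridiagonal hJ, smul_eq_mul]
  push_cast
  ring

theorem norm_le_of_apply_eq_sub {t : ℝ} {u w : EllTwo}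
    (hw : ∀ n, w n = (t : ℂ) * (u (n + 1) - u (n - 1))) : ‖w‖ ≤ 2 * |t| * ‖u‖ := by
  have h₁ : HasSum (fun n => ‖u (n + 1)‖ ^ 2) (‖u‖ ^ 2) :=
    ((Equiv.addRight (1 : ℤ)).hasSum_iff (f := fun n : ℤ => ‖u n‖ ^ 2)).2 (EllTwo.hasSum_norm_sq u)
  have h₂ : HasSum (fun n => ‖u (n - 1)‖ ^ 2) (‖u‖ ^ 2) :=
    ((Equiv.subRight (1 : ℤ)).hasSum_iff (f := fun n : ℤ => ‖u n‖ ^ 2)).2 (EllTwo.hasSum_norm_sq u)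
  have h₃ : ∀ n, ‖w n‖ ^ 2 ≤ 2 * |t| ^ 2 * (‖u (n + 1)‖ ^ 2 + ‖u (n - 1)‖ ^ 2) := by
    intro n
    have h₄ : ‖u (n + 1) - u (n - 1)‖ ^ 2 ≤ 2 * (‖u (n + 1)‖ ^ 2 + ‖u (n - 1)‖ ^ 2) := by
      have h₅ := norm_sub_le (u (n + 1)) (u (n - 1))
      nlinarith [sq_nonneg (‖u (n + 1)‖ - ‖u (n - 1)‖), norm_nonneg (u (n + 1) - u (n - 1))]
    rw [hw, norm_mul, mul_pow, Complex.norm_real, Real.norm_eq_abs]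
    nlinarith [mul_le_mul_of_nonneg_left h₄ (sq_nonneg |t|)]
  have h₆ := hasSum_le h₃ (EllTwo.hasSum_norm_sq w) ((h₁.add h₂).mul_left (2 * |t| ^ 2))
  refine le_of_pow_le_pow_left₀ two_ne_zero (by positivity) (h₆.trans_eq ?_)
  ring

theorem norm_sub_adjoint_apply_le
    (hJ : ∀ u : EllTwo, ∀ n : ℤ,
      J u n = (c : ℂ) * u (n - 1) + (a n : ℂ) * u n + (b : ℂ) * u (n + 1)) (u : EllTwo) :
    ‖((2⁻¹ : ℂ) • (J - J.adjoint)) u‖ ≤ |b - c| * ‖u‖ := by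
  have h₁ : ∀ n, ((2⁻¹ : ℂ) • (J - J.adjoint)) u n =
      ((b - c) / 2 : ℝ) * (u (n + 1) - u (n - 1)) := by
    intro n
    rw [smul_apply, sub_apply, lp.coeFn_smul, Pi.smul_apply, lp.coeFn_sub, Pi.sub_apply, hJ,
      adjoint_apply_of_tridiagonal hJ, smul_eq_mul]
    push_cast
    ring
  refine (norm_le_of_apply_eq_sub h₁).trans_eq ?_
  rw [abs_div, abs_two]
  ring

end Adjoint

open Matrix in
/-- A tridiagonal operator with periodic diagonal whose pseudospectrum is connected has no two
diagonal entries that are far apart. -/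
theorem sub_le_of_isPathConnected_pseudospectrum {q : ℕ} {a : ℤ → ℝ}
    (ha : ∀ n : ℤ, a (n + (q + 1 : ℕ)) = a n) {b c : ℝ} {J : EllTwo →L[ℂ] EllTwo}
    (hJ : ∀ u : EllTwo, ∀ n : ℤ,
      J u n = (c : ℂ) * u (n - 1) + (a n : ℂ) * u n + (b : ℂ) * u (n + 1))
    {ε : ℝ} (hε : 0 < ε) (hconn : IsPathConnected (pseudospectrum ε J)) (n m : ℤ) :
    a n - a m ≤ 2 * (ε + |b - c|) * q := by
  by_contra! hlt
  let h := (b + c) / 2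
  obtain ⟨μ, f, hμ, hf, hfμ, hμsum⟩ :=
    exists_antitone_eigenbasis (dirichletMatrix_isHermitian q a h m)
  obtain ⟨ν, g, hν, hg, hgν, hνsum⟩ :=
    exists_antitone_eigenbasis (dirichletMatrix_isHermitian q a h n)
  have htr : ∀ l : ℤ, (dirichletMatrix q a h l).trace =
      ∑ s ∈ Finset.range (q + 1), a s - a l := by
    intro l
    rw [trace_dirichletMatrix, ← sum_range_add_of_periodic ha l, Finset.sum_range_succ',
      Finset.sum_range]
    simp [add_assoc, add_comm (1 : ℤ)]
  obtain ⟨k, hk⟩ : ∃ k, 2 * (ε + |b - c|) < μ k - ν k := by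
    by_contra! hle
    have h₁ := Finset.sum_le_sum fun k (_ : k ∈ Finset.univ) => hle k
    rw [Finset.sum_sub_distrib, hμsum, hνsum, htr, htr] at h₁
    simp only [Finset.sum_const, Finset.card_univ, Fintype.card_fin, nsmul_eq_mul] at h₁
    linarith
  let x := (μ k + ν k) / 2
  let η := (μ k - ν k) / 2
  have hxη : x + η = μ k := by simp only [x, η]; ring
  have hxη' : x - η = ν k := by simp only [x, η]; ring
  have hη : ε + |b - c| < η := by simp only [η]; linarith
  have hκ := abs_nonneg (b - c)
  have hη₀ : 0 < η := by linarith
  have hone : ∀ {f : Fin q → Fin q → ℝ}, (∀ i j, f i ⬝ᵥ f j = if i = j then 1 else 0) →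
      ∀ i, f i ⬝ᵥ f i = 1 := fun hf i => by rw [hf, if_pos rfl]
  have hS := isJacobi_realPart hJ
  obtain ⟨e, he⟩ := hS.exists_inner_eq (hone hf k) (hfμ k) x
  obtain ⟨e', he'⟩ := hS.exists_inner_eq (hone hg k) (hgν k) x
  set S : EllTwo →L[ℂ] EllTwo := (2⁻¹ : ℂ) • (J + J.adjoint) with hSdef
  set K : EllTwo →L[ℂ] EllTwo := (2⁻¹ : ℂ) • (J - J.adjoint) with hKdef
  have hstar : star (2⁻¹ : ℂ) = 2⁻¹ := by simp
  have hSadj : IsSelfAdjoint S := by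
    rw [hSdef, isSelfAdjoint_iff, star_smul, hstar, star_add, ContinuousLinearMap.star_eq_adjoint,
      ContinuousLinearMap.star_eq_adjoint, ContinuousLinearMap.adjoint_adjoint, add_comm]
  have hKadj : K.adjoint = -K := by
    rw [hKdef, ← ContinuousLinearMap.star_eq_adjoint, star_smul, hstar, star_sub,
      ContinuousLinearMap.star_eq_adjoint, ContinuousLinearMap.star_eq_adjoint,
      ContinuousLinearMap.adjoint_adjoint, ← smul_neg, neg_sub]
  have hsum : S + K = J := by
    rw [hSdef, hKdef, ← smul_add, add_add_sub_cancel, ← two_smul ℂ J, smul_smul]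
    norm_num
  have hK := norm_sub_adjoint_apply_le hJ
  refine not_isPathConnected_pseudospectrum (S := S) (K := K) (x := x) hε hκ hη hSadj ?_ hK
    (fun u => ?_) (e := e) (f := e') ?_ ?_ (hsum ▸ hconn)
  · refine hS.le_norm_sub_smul ha fun N _ w hw => ?_
    refine sum_sq_le_of_dirichlet (ι := Set.Iic k) (κ := Set.Ici k) ?_ hη₀ ha (m := m) (n := n)
      (f := fun i => f i) (μ := fun i => μ i) (fun i => hone hf i) (fun i j hij => ?_)
      (fun i => hfμ i) (fun i => ?_) (g := fun i => g i) (ν := fun i => ν i) (fun i => hone hg i)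
      (fun i j hij => ?_) (fun i => hgν i) (fun i => ?_) hw
    · rw [← Set.toFinset_card, ← Set.toFinset_card, Set.toFinset_Iic, Set.toFinset_Ici,
        Fin.card_Iic, Fin.card_Ici]
      have := k.isLt
      omega
    · rw [hf, if_neg fun hc => hij (Subtype.ext hc)]
    · exact hxη.trans_le (hμ i.2)
    · rw [hg, if_neg fun hc => hij (Subtype.ext hc)]
    · exact (hν i.2).trans_eq hxη'.symm
  · rw [hKadj, _root_.neg_apply, norm_neg]
    exact hK u
  · rw [he, ← hxη]
    linarith
  · rw [he', ← hxη']
    linarith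

theorem osc_le_of_pseudospectrum_pathConnected_constant_offdiagonal
    (p : ℕ) (hp : 2 ≤ p) (a : ℤ → ℝ) (ha : ∀ n : ℤ, a (n + p) = a n) (b c : ℝ)
    (J : lp (fun _ : ℤ => ℂ) 2 →L[ℂ] lp (fun _ : ℤ => ℂ) 2)
    (hJ : ∀ u : lp (fun _ : ℤ => ℂ) 2, ∀ n : ℤ,
      J u n = (c : ℂ) * u (n - 1) + (a n : ℂ) * u n + (b : ℂ) * u (n + 1))
    (ε : ℝ) (hε : 0 < ε) (hconn : IsPathConnected (pseudospectrum ε J)) :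
    osc p a ≤ 2 * (ε + |b - c|) * ((p : ℝ) - 1) := by
  obtain ⟨q, rfl⟩ : ∃ q, p = q + 1 := ⟨p - 1, by omega⟩
  rw [Nat.cast_add_one, add_sub_cancel_right]
  have key := sub_le_of_isPathConnected_pseudospectrum ha hJ hε hconn
  exact ciSup_le fun i => ciSup_le fun j => abs_sub_le_iff.2 ⟨key _ _, key _ _⟩
end
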